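/- Theorem 4.5. Let ε > 0 be an arbitrarily small constant and suppose k = k(n) = c(n)·n where c = c(n) satisfies ε ≤ c ≤ (ln n)². Then there exists a constant C > 0 such that asymptotically almost surely |ξ(K_n, k) / ((1/ln(1+c) + 1/c)·ln n) − 1| ≤ C/√(ln ln ln n); in particular, a.a.s. ξ(K_n,k) ~ (1/ln(1+c) + 1/c)·ln n. -/

import Mathlib

open Finset Filter

/-- Positions: `p t a` is the vertex (an element of `Fin n`) occupied by agent `a` at the end of
round `t`. `greenSet n k p t` is the set of green agents at the end of round `t`; the initially
green agent is the agent with index `0`, and a white agent becomes green as soon as it occupies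
the same vertex as a green agent. -/
def greenSet (n k : ℕ) (p : ℕ → Fin k → Fin n) : ℕ → Finset (Fin k)
  | 0 => Finset.univ.filter fun a => ∃ b : Fin k, (b : ℕ) = 0 ∧ p 0 a = p 0 b
  | t + 1 =>
      greenSet n k p t ∪
        Finset.univ.filter fun a => ∃ b ∈ greenSet n k p t, p (t + 1) a = p (t + 1) b

/-- The probability that the `k` agents follow the trajectory prefix `p` during rounds
`0, 1, …, T`: each agent starts at a uniformly random vertex of `K_n` and then moves, each round
and independently of everything else, to a uniformly random vertex distinct from its current
one. -/
noncomputable def prefixProb (n k T : ℕ) (p : Fin (T + 1) → Fin k → Fin n) : ℝ :=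
  ∏ a : Fin k, ((n : ℝ)⁻¹ *
    ∏ t : Fin T, if p t.succ a = p t.castSucc a then 0 else ((n : ℝ) - 1)⁻¹)

/-- `probXiLe n k T` is `P(ξ(K_n, k) ≤ T)`: the probability that the broadcast is complete by
the end of round `T`. -/
noncomputable def probXiLe (n k T : ℕ) : ℝ :=
  ∑ p : Fin (T + 1) → Fin k → Fin n,
    if greenSet n k (fun t a => p ⟨min t T, Nat.lt_succ_of_le (min_le_right t T)⟩ a) T
        = Finset.univ
      then prefixProb n k T p else 0

/-- `probXiEq n k t` is `P(ξ(K_n, k) = t)`. -/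
noncomputable def probXiEq (n k : ℕ) : ℕ → ℝ
  | 0 => probXiLe n k 0
  | t + 1 => probXiLe n k (t + 1) - probXiLe n k t

/-- `probXiMem n k S` is `P(ξ(K_n, k) ∈ S)`: the probability that the broadcasting time of the
process with `k` agents on `K_n` belongs to the set `S ⊆ ℕ`. -/
noncomputable def probXiMem (n k : ℕ) (S : Set ℕ) : ℝ :=
  ∑' t, S.indicator (probXiEq n k) t

/-- `expXi n k = E[ξ(K_n, k)] = ∑_{t ≥ 0} P(ξ(K_n, k) > t)`. -/
noncomputable def expXi (n k : ℕ) : ℝ :=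
  ∑' t, (1 - probXiLe n k t)

set_option linter.unusedSectionVars false

section Expectation

variable {α V : Type*} [Fintype α] [DecidableEq α] [Fintype V]

/-- Expectation of `F y` when the coordinates `y a` are independent with weights `κ a`. -/
noncomputable def prodExp (κ : α → V → ℝ) (F : (α → V) → ℝ) : ℝ :=
  ∑ y : α → V, (∏ a, κ a (y a)) * F y

/-- Each `κ a` is a probability weight. -/
structure IsKernel (κ : α → V → ℝ) : Prop where
  nonneg : ∀ a v, 0 ≤ κ a v
  sum_one : ∀ a, ∑ v, κ a v = 1

lemma prodExp_mono {κ : α → V → ℝ} (hκ : IsKernel κ) {F H : (α → V) → ℝ} (h : ∀ y, F y ≤ H y) :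
    prodExp κ F ≤ prodExp κ H :=
  Finset.sum_le_sum fun y _ =>
    mul_le_mul_of_nonneg_left (h y) (Finset.prod_nonneg fun a _ => hκ.nonneg a _)

lemma prodExp_add (κ : α → V → ℝ) (F H : (α → V) → ℝ) :
    prodExp κ (fun y => F y + H y) = prodExp κ F + prodExp κ H := by
  simp [prodExp, mul_add, Finset.sum_add_distrib]

lemma prodExp_sub (κ : α → V → ℝ) (F H : (α → V) → ℝ) :
    prodExp κ (fun y => F y - H y) = prodExp κ F - prodExp κ H := by
  simp [prodExp, mul_sub, Finset.sum_sub_distrib]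

lemma prodExp_const_mul (κ : α → V → ℝ) (r : ℝ) (F : (α → V) → ℝ) :
    prodExp κ (fun y => r * F y) = r * prodExp κ F := by
  simp only [prodExp, Finset.mul_sum]
  exact Finset.sum_congr rfl fun y _ => by ring

lemma prodExp_finset_sum {ι : Type*} (κ : α → V → ℝ) (s : Finset ι) (F : ι → (α → V) → ℝ) :
    prodExp κ (fun y => ∑ i ∈ s, F i y) = ∑ i ∈ s, prodExp κ (F i) := by
  simp only [prodExp, Finset.mul_sum]
  exact Finset.sum_comm

lemma prodExp_prod (κ f : α → V → ℝ) :
    prodExp κ (fun y => ∏ a, f a (y a)) = ∏ a, ∑ v, κ a v * f a v := by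
  simp only [prodExp, ← Finset.prod_mul_distrib]
  rw [Finset.prod_univ_sum, Fintype.piFinset_univ]

lemma prodExp_const {κ : α → V → ℝ} (hκ : IsKernel κ) (r : ℝ) : prodExp κ (fun _ => r) = r := by
  have h := prodExp_prod κ (fun _ _ => 1)
  simp only [Finset.prod_const_one, mul_one, hκ.sum_one] at h
  have h' := prodExp_const_mul κ r (fun _ => 1)
  rw [h] at h'
  simpa using h'

lemma prodExp_nonneg {κ : α → V → ℝ} (hκ : IsKernel κ) {F : (α → V) → ℝ} (h : ∀ y, 0 ≤ F y) :
    0 ≤ prodExp κ F :=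
  Finset.sum_nonneg fun y _ => mul_nonneg (Finset.prod_nonneg fun a _ => hκ.nonneg a _) (h y)

lemma prodExp_prod_finset {κ : α → V → ℝ} (hκ : IsKernel κ) (A : Finset α) (f : α → V → ℝ) :
    prodExp κ (fun y => ∏ a ∈ A, f a (y a)) = ∏ a ∈ A, ∑ v, κ a v * f a v := by
  have h := prodExp_prod κ (fun a v => if a ∈ A then f a v else 1)
  have h1 : ∀ y : α → V, ∏ a, (if a ∈ A then f a (y a) else 1) = ∏ a ∈ A, f a (y a) := by
    intro y; simp [Finset.prod_ite_mem]
  simp only [h1] at h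
  rw [h, ← Finset.prod_subset (Finset.subset_univ A)]
  · exact Finset.prod_congr rfl fun a ha => by simp [ha]
  · intro a _ ha
    simp [ha, hκ.sum_one]

/-- Resampling one coordinate does not change the expectation. -/
lemma prodExp_resample {κ : α → V → ℝ} (hκ : IsKernel κ) (b : α) (F : (α → V) → ℝ) :
    prodExp κ F = prodExp κ (fun y => ∑ v, κ b v * F (Function.update y b v)) := by
  have hw : ∀ (y : α → V) (v : V), κ b v * ∏ a, κ a (y a)
      = κ b (y b) * ∏ a, κ a (Function.update y b v a) := by
    intro y v
    rw [Fintype.prod_eq_mul_prod_compl b, Fintype.prod_eq_mul_prod_compl b]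
    have : ∏ a ∈ {b}ᶜ, κ a (Function.update y b v a) = ∏ a ∈ {b}ᶜ, κ a (y a) := by
      refine Finset.prod_congr rfl fun a ha => ?_
      rw [Function.update_of_ne (by simpa using ha)]
    rw [this, Function.update_self]
    ring
  let e : (α → V) × V ≃ (α → V) × V :=
    { toFun := fun p => (Function.update p.1 b p.2, p.1 b)
      invFun := fun p => (Function.update p.1 b p.2, p.1 b)
      left_inv := fun p => by simp
      right_inv := fun p => by simp }
  calc prodExp κ F = ∑ p : (α → V) × V, κ b p.2 * ((∏ a, κ a (p.1 a)) * F p.1) := by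
        rw [Fintype.sum_prod_type]
        simp only [← Finset.sum_mul, hκ.sum_one, one_mul, prodExp]
    _ = ∑ p : (α → V) × V,
          κ b p.2 * ((∏ a, κ a (p.1 a)) * F (Function.update p.1 b p.2)) := by
        symm
        refine Fintype.sum_equiv e _ _ fun p => ?_
        simp only [e, Equiv.coe_fn_mk]
        rw [← mul_assoc, hw, mul_assoc]
    _ = _ := by
        rw [Fintype.sum_prod_type, prodExp]
        simp only [Finset.mul_sum]
        exact Finset.sum_congr rfl fun y _ => Finset.sum_congr rfl fun v _ => by ring

/-- Markov's inequality. -/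
lemma prodExp_markov {κ : α → V → ℝ} (hκ : IsKernel κ) {F : (α → V) → ℝ} (h : ∀ y, 0 ≤ F y)
    {r : ℝ} (hr : 0 < r) (P : (α → V) → Prop) [DecidablePred P] (hP : ∀ y, P y → r ≤ F y) :
    prodExp κ (fun y => if P y then 1 else 0) ≤ prodExp κ F / r := by
  rw [le_div_iff₀ hr, mul_comm, ← prodExp_const_mul]
  refine prodExp_mono hκ fun y => ?_
  split_ifs with hy
  · simpa using hP y hy
  · simpa using h y

end Expectation

section OneRound

variable {α V : Type*} [Fintype α] [DecidableEq α] [Fintype V] [DecidableEq V]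

/-- The agents that are green after the agents in `A` were green and all agents moved to `y`. -/
def spread (A : Finset α) (y : α → V) : Finset α :=
  A ∪ Finset.univ.filter fun a => ∃ b ∈ A, y a = y b

lemma subset_spread (A : Finset α) (y : α → V) : A ⊆ spread A y := Finset.subset_union_left

/-- Indicator that, at the positions `y`, agent `a` meets no agent of `A`. -/
noncomputable def avoids (A : Finset α) (y : α → V) (a : α) : ℝ :=
  if ∃ b ∈ A, y a = y b then 0 else 1

lemma card_compl_spread (A : Finset α) (y : α → V) :
    ((spread A y)ᶜ.card : ℝ) = ∑ a ∈ Aᶜ, avoids A y a := by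
  have h : (spread A y)ᶜ = Aᶜ.filter fun a => ¬ ∃ b ∈ A, y a = y b := by
    ext a; simp [spread]
  rw [h, Finset.card_filter, Nat.cast_sum]
  refine Finset.sum_congr rfl fun a _ => ?_
  by_cases hP : ∃ b ∈ A, y a = y b
  · rw [avoids, if_pos hP, if_neg (not_not.2 hP), Nat.cast_zero]
  · rw [avoids, if_neg hP, if_pos hP, Nat.cast_one]

lemma avoids_update_self {A : Finset α} (y : α → V) {a : α} (ha : a ∉ A) (v : V) :
    avoids A (Function.update y a v) a = ∏ b ∈ A, if y b = v then (0 : ℝ) else 1 := by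
  have hne : ∀ b ∈ A, b ≠ a := fun b hb h => ha (h ▸ hb)
  unfold avoids
  split_ifs with h
  · obtain ⟨b, hb, hbv⟩ := h
    rw [Function.update_self, Function.update_of_ne (hne b hb)] at hbv
    rw [Finset.prod_eq_zero hb (by simp [hbv])]
  · rw [Finset.prod_eq_one]
    intro b hb
    rw [if_neg]
    intro hbv
    exact h ⟨b, hb, by rw [Function.update_self, Function.update_of_ne (hne b hb), hbv]⟩

lemma avoids_update_of_ne {A : Finset α} (y : α → V) {a c : α} (ha : a ∉ A) (hc : c ≠ a) (v : V) :
    avoids A (Function.update y a v) c = avoids A y c := by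
  have hne : ∀ b ∈ A, b ≠ a := fun b hb h => ha (h ▸ hb)
  have : (∃ b ∈ A, Function.update y a v c = Function.update y a v b) ↔ ∃ b ∈ A, y c = y b := by
    refine exists_congr fun b => and_congr_right fun hb => ?_
    rw [Function.update_of_ne (hne b hb), Function.update_of_ne hc]
  unfold avoids
  simp only [this]

/-- The probability that no agent of `A` moves to `u`. -/
noncomputable def emptyProb (κ : α → V → ℝ) (A : Finset α) (u : V) : ℝ := ∏ b ∈ A, (1 - κ b u)

/-- The probability that agent `a ∉ A` meets no agent of `A`. -/
noncomputable def avoidProb (κ : α → V → ℝ) (A : Finset α) (a : α) : ℝ :=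
  ∑ u, κ a u * emptyProb κ A u

variable {κ : α → V → ℝ}

lemma IsKernel.le_one (hκ : IsKernel κ) (a : α) (v : V) : κ a v ≤ 1 := by
  rw [← hκ.sum_one a]
  exact Finset.single_le_sum (fun u _ => hκ.nonneg a u) (Finset.mem_univ v)

lemma emptyProb_nonneg (hκ : IsKernel κ) (A : Finset α) (u : V) : 0 ≤ emptyProb κ A u :=
  Finset.prod_nonneg fun b _ => by linarith [hκ.le_one b u]

lemma avoidProb_nonneg (hκ : IsKernel κ) (A : Finset α) (a : α) : 0 ≤ avoidProb κ A a :=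
  Finset.sum_nonneg fun u _ => mul_nonneg (hκ.nonneg a u) (emptyProb_nonneg hκ A u)

lemma prodExp_isEmpty (hκ : IsKernel κ) (A : Finset α) (u : V) :
    prodExp κ (fun y => ∏ b ∈ A, if y b = u then (0 : ℝ) else 1) = emptyProb κ A u := by
  rw [prodExp_prod_finset hκ A fun _ v => if v = u then (0 : ℝ) else 1]
  refine Finset.prod_congr rfl fun b _ => ?_
  have h : ∀ v, κ b v * (if v = u then (0 : ℝ) else 1) = κ b v - if v = u then κ b v else 0 := by
    intro v; split_ifs <;> simp
  simp only [h, Finset.sum_sub_distrib, hκ.sum_one, Finset.sum_ite_eq', Finset.mem_univ, if_true]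

lemma prodExp_avoids (hκ : IsKernel κ) (A : Finset α) {a : α} (ha : a ∉ A) :
    prodExp κ (fun y => avoids A y a) = avoidProb κ A a := by
  rw [prodExp_resample hκ a]
  simp only [avoids_update_self _ ha]
  rw [prodExp_finset_sum]
  refine Finset.sum_congr rfl fun u _ => ?_
  rw [prodExp_const_mul, prodExp_isEmpty hκ]

lemma prodExp_isEmpty_pair_le (hκ : IsKernel κ) (A : Finset α) (u v : V) :
    prodExp κ (fun y => (∏ b ∈ A, if y b = u then (0 : ℝ) else 1) *
      ∏ b ∈ A, if y b = v then (0 : ℝ) else 1)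
      ≤ emptyProb κ A u * emptyProb κ A v + if u = v then emptyProb κ A u else 0 := by
  have hu := emptyProb_nonneg hκ A u
  have hv := emptyProb_nonneg hκ A v
  by_cases huv : u = v
  · subst huv
    have : ∀ y : α → V, (∏ b ∈ A, if y b = u then (0 : ℝ) else 1) *
        (∏ b ∈ A, if y b = u then (0 : ℝ) else 1) = ∏ b ∈ A, if y b = u then (0 : ℝ) else 1 := by
      intro y
      rw [← Finset.prod_mul_distrib]
      exact Finset.prod_congr rfl fun b _ => by split_ifs <;> simp
    simp only [this, prodExp_isEmpty hκ, if_true]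
    nlinarith
  · rw [if_neg huv, add_zero]
    simp only [← Finset.prod_mul_distrib]
    rw [prodExp_prod_finset hκ A
      fun _ w => (if w = u then (0 : ℝ) else 1) * if w = v then (0 : ℝ) else 1]
    simp only [emptyProb, ← Finset.prod_mul_distrib]
    have key : ∀ b, ∑ w, κ b w * ((if w = u then (0 : ℝ) else 1) * if w = v then (0 : ℝ) else 1)
        = 1 - κ b u - κ b v := by
      intro b
      have h : ∀ w, κ b w * ((if w = u then (0 : ℝ) else 1) * if w = v then (0 : ℝ) else 1)
          = κ b w - (if w = u then κ b w else 0) - if w = v then κ b w else 0 := by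
        intro w
        by_cases h1 : w = u
        · have h2 : w ≠ v := h1 ▸ huv
          simp [h1, huv]
        · simp [h1]; split_ifs <;> simp
      simp only [h, Finset.sum_sub_distrib, hκ.sum_one, Finset.sum_ite_eq', Finset.mem_univ,
        if_true]
    refine Finset.prod_le_prod (fun b _ => ?_) fun b _ => ?_
    · exact Finset.sum_nonneg fun w _ => mul_nonneg (hκ.nonneg b w)
        (mul_nonneg (by split_ifs <;> norm_num) (by split_ifs <;> norm_num))
    · rw [key]
      nlinarith [hκ.nonneg b u, hκ.nonneg b v]

lemma prodExp_avoids_mul_le (hκ : IsKernel κ) {r : ℝ} (hr : ∀ a v, κ a v ≤ r) (A : Finset α)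
    {a c : α} (ha : a ∉ A) (hc : c ∉ A) (hac : a ≠ c) :
    prodExp κ (fun y => avoids A y a * avoids A y c)
      ≤ avoidProb κ A a * avoidProb κ A c + r * avoidProb κ A a := by
  have h1 : prodExp κ (fun y => avoids A y a * avoids A y c) =
      ∑ u, ∑ v, κ a u * κ c v * prodExp κ (fun y => (∏ b ∈ A, if y b = u then (0 : ℝ) else 1) *
        ∏ b ∈ A, if y b = v then (0 : ℝ) else 1) := by
    rw [prodExp_resample hκ a]
    simp only [avoids_update_self _ ha, avoids_update_of_ne _ ha hac.symm]
    rw [prodExp_finset_sum]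
    refine Finset.sum_congr rfl fun u _ => ?_
    rw [prodExp_const_mul, prodExp_resample hκ c]
    have h2 : ∀ (y : α → V) v, (∏ b ∈ A, if Function.update y c v b = u then (0 : ℝ) else 1)
        = ∏ b ∈ A, if y b = u then (0 : ℝ) else 1 := by
      intro y v
      refine Finset.prod_congr rfl fun b hb => ?_
      rw [Function.update_of_ne (by rintro rfl; exact hc hb)]
    simp only [avoids_update_self _ hc, h2]
    rw [prodExp_finset_sum, Finset.mul_sum]
    refine Finset.sum_congr rfl fun v _ => ?_
    rw [prodExp_const_mul, mul_assoc]
  rw [h1]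
  calc _ ≤ ∑ u, ∑ v, κ a u * κ c v *
          (emptyProb κ A u * emptyProb κ A v + if u = v then emptyProb κ A u else 0) := by
        refine Finset.sum_le_sum fun u _ => Finset.sum_le_sum fun v _ => ?_
        exact mul_le_mul_of_nonneg_left (prodExp_isEmpty_pair_le hκ A u v)
          (mul_nonneg (hκ.nonneg _ _) (hκ.nonneg _ _))
    _ = avoidProb κ A a * avoidProb κ A c + ∑ u, κ a u * κ c u * emptyProb κ A u := by
        simp only [mul_add, Finset.sum_add_distrib, mul_ite, mul_zero, Finset.sum_ite_eq,
          Finset.mem_univ, if_true, avoidProb, Finset.sum_mul_sum]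
        congr 1
        exact Finset.sum_congr rfl fun u _ => Finset.sum_congr rfl fun v _ => by ring
    _ ≤ _ := by
        refine add_le_add le_rfl ?_
        rw [avoidProb, Finset.mul_sum]
        refine Finset.sum_le_sum fun u _ => ?_
        have := mul_nonneg (hκ.nonneg a u) (emptyProb_nonneg hκ A u)
        nlinarith [hr c u]

lemma le_avoidProb (hκ : IsKernel κ) {r : ℝ} (hr : ∀ a v, κ a v ≤ r) (hr1 : r ≤ 1) (A : Finset α)
    (a : α) : (1 - r) ^ A.card ≤ avoidProb κ A a := by
  calc (1 - r) ^ A.card = ∑ u, κ a u * (1 - r) ^ A.card := by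
        rw [← Finset.sum_mul, hκ.sum_one, one_mul]
    _ ≤ _ := by
        refine Finset.sum_le_sum fun u _ => mul_le_mul_of_nonneg_left ?_ (hκ.nonneg a u)
        rw [emptyProb, ← Finset.prod_const]
        exact Finset.prod_le_prod (fun _ _ => by linarith) fun b _ => by linarith [hr b u]

/-- The expected number of white agents after a round, in terms of the avoidance probabilities. -/
lemma prodExp_white (hκ : IsKernel κ) (A : Finset α) :
    prodExp κ (fun y => ((spread A y)ᶜ.card : ℝ)) = ∑ a ∈ Aᶜ, avoidProb κ A a := by
  simp only [card_compl_spread]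
  rw [prodExp_finset_sum]
  exact Finset.sum_congr rfl fun a ha => prodExp_avoids hκ A (Finset.mem_compl.1 ha)

/-- The expected number of green agents grows at most by the factor `1 + r * |α|`. -/
lemma prodExp_green_le (hκ : IsKernel κ) {r : ℝ} (hr0 : 0 ≤ r) (hr : ∀ a v, κ a v ≤ r)
    (hr1 : r ≤ 1) (A : Finset α) :
    prodExp κ (fun y => ((spread A y).card : ℝ)) ≤ (1 + r * Fintype.card α) * A.card := by
  have h : ∀ y : α → V, ((spread A y).card : ℝ) = Fintype.card α - ((spread A y)ᶜ.card : ℝ) := by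
    intro y
    rw [← Finset.card_compl_add_card (spread A y)]
    push_cast; ring
  simp only [h]
  rw [prodExp_sub, prodExp_const hκ, prodExp_white hκ]
  have h1 : ∀ a ∈ Aᶜ, 1 - r * A.card ≤ avoidProb κ A a := by
    intro a _
    refine le_trans ?_ (le_avoidProb hκ hr hr1 A a)
    have := one_add_mul_le_pow (a := -r) (by linarith) A.card
    rw [← sub_eq_add_neg] at this
    linarith
  have h2 := Finset.sum_le_sum h1
  rw [Finset.sum_const, nsmul_eq_mul] at h2
  have h3 : (Fintype.card α : ℝ) = (Aᶜ.card : ℝ) + A.card := by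
    rw [← Finset.card_compl_add_card A]; push_cast; ring
  have h4 : 0 ≤ r * (A.card : ℝ) * A.card := by positivity
  rw [h3]
  linarith

/-- Chebyshev's inequality for the number of white agents after a round. -/
lemma prodExp_white_small (hκ : IsKernel κ) {r η w : ℝ} (hr0 : 0 ≤ r)
    (hr : ∀ a v, κ a v ≤ r) (hr1 : r < 1) (hη : 0 < η) (hη1 : η ≤ 1) (hw : 0 < w) (A : Finset α)
    (hA : w ≤ (Aᶜ.card : ℝ)) :
    prodExp κ (fun y => if ((spread A y)ᶜ.card : ℝ) <
        (1 - η) * (1 - r) ^ Fintype.card α * w then 1 else 0)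
      ≤ (1 + r * Fintype.card α) / (η ^ 2 * (1 - r) ^ Fintype.card α * w) := by
  set q := (1 - r) ^ Fintype.card α with hq
  have hq0 : 0 < q := pow_pos (by linarith) _
  set μ := ∑ a ∈ Aᶜ, avoidProb κ A a with hμ
  have hμlow : q * w ≤ μ := by
    have h1 : ∀ a ∈ Aᶜ, q ≤ avoidProb κ A a := fun a _ =>
      le_trans (pow_le_pow_of_le_one (by linarith) (by linarith) (Finset.card_le_univ A))
        (le_avoidProb hκ hr hr1.le A a)
    have h2 := Finset.sum_le_sum h1
    rw [Finset.sum_const, nsmul_eq_mul] at h2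
    nlinarith
  have hμ0 : 0 < μ := lt_of_lt_of_le (mul_pos hq0 hw) hμlow
  have hsq : prodExp κ (fun y => ((spread A y)ᶜ.card : ℝ) ^ 2)
      ≤ μ ^ 2 + μ * (1 + r * Fintype.card α) := by
    simp only [card_compl_spread, sq, Finset.sum_mul_sum]
    rw [prodExp_finset_sum]
    simp only [prodExp_finset_sum]
    calc _ ≤ ∑ a ∈ Aᶜ, ∑ c ∈ Aᶜ, (avoidProb κ A a * avoidProb κ A c + r * avoidProb κ A a
            + if a = c then avoidProb κ A a else 0) := by
          refine Finset.sum_le_sum fun a ha => Finset.sum_le_sum fun c hc => ?_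
          rw [Finset.mem_compl] at ha hc
          have hs := avoidProb_nonneg hκ A a
          by_cases hac : a = c
          · subst hac
            have : ∀ y : α → V, avoids A y a * avoids A y a = avoids A y a := by
              intro y; unfold avoids; split_ifs <;> simp
            simp only [this, prodExp_avoids hκ A ha, if_true]
            nlinarith [mul_nonneg hr0 hs]
          · rw [if_neg hac, add_zero]
            exact prodExp_avoids_mul_le hκ hr A ha hc hac
      _ = μ * μ + Aᶜ.card * (r * μ) + μ := by
          simp only [Finset.sum_add_distrib, ← Finset.sum_mul_sum, Finset.sum_const,
            nsmul_eq_mul, Finset.sum_ite_eq, hμ, Finset.mul_sum]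
          congr 1
          exact Finset.sum_congr rfl fun a ha => by simp only [if_pos ha]
      _ ≤ _ := by
          have : (Aᶜ.card : ℝ) ≤ Fintype.card α := by exact_mod_cast Finset.card_le_univ _
          nlinarith [mul_le_mul_of_nonneg_right this (mul_nonneg hr0 hμ0.le)]
  have hvar : prodExp κ (fun y => (((spread A y)ᶜ.card : ℝ) - μ) ^ 2)
      ≤ μ * (1 + r * Fintype.card α) := by
    have h : ∀ y : α → V, (((spread A y)ᶜ.card : ℝ) - μ) ^ 2
        = (((spread A y)ᶜ.card : ℝ) ^ 2 - 2 * μ * ((spread A y)ᶜ.card : ℝ)) + μ ^ 2 := by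
      intro y; ring
    simp only [h]
    rw [prodExp_add, prodExp_sub, prodExp_const_mul, prodExp_const hκ, prodExp_white hκ, ← hμ]
    linarith
  refine (prodExp_markov hκ (F := fun y => (((spread A y)ᶜ.card : ℝ) - μ) ^ 2)
    (fun y => sq_nonneg _) (r := (η * μ) ^ 2) (by positivity) _ ?_).trans ?_
  · intro y hy
    have : η * μ ≤ μ - ((spread A y)ᶜ.card : ℝ) := by
      have : (1 - η) * q * w ≤ (1 - η) * μ := by
        rw [mul_assoc]; exact mul_le_mul_of_nonneg_left hμlow (by linarith)
      linarith
    have h0 : 0 ≤ η * μ := by positivity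
    nlinarith
  · calc _ ≤ μ * (1 + r * Fintype.card α) / (η * μ) ^ 2 := by gcongr
      _ = (1 + r * Fintype.card α) / (η ^ 2 * μ) := by field_simp
      _ ≤ _ := by
        rw [mul_assoc]
        have : 0 ≤ r * (Fintype.card α : ℝ) := by positivity
        gcongr

end OneRound

section Laplace

variable {α V : Type*} [Fintype α] [DecidableEq α] [Fintype V] [DecidableEq V]

variable {κ : α → V → ℝ}

/-- Averaging over the moves of the agents in `B`, given the moves of the agents in `A`. -/
lemma prodExp_condition (hκ : IsKernel κ) (A : Finset α) (g : (α → V) → V → ℝ)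
    (hg : ∀ y a v u, a ∉ A → g (Function.update y a v) u = g y u) (B : Finset α)
    (hB : Disjoint B A) (H : (α → V) → ℝ)
    (hH : ∀ y a v, a ∉ A → H (Function.update y a v) = H y) :
    prodExp κ (fun y => H y * ∏ a ∈ B, g y (y a))
      = prodExp κ (fun y => H y * ∏ a ∈ B, ∑ v, κ a v * g y v) := by
  induction B using Finset.induction_on generalizing H with
  | empty => simp
  | insert a B haB ih =>
    rw [Finset.disjoint_insert_left] at hB
    obtain ⟨haA, hBA⟩ := hB
    rw [prodExp_resample hκ a]
    have h1 : ∀ y : α → V, (∑ v, κ a v * (H (Function.update y a v) *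
        ∏ c ∈ insert a B, g (Function.update y a v) (Function.update y a v c)))
        = (H y * ∑ v, κ a v * g y v) * ∏ c ∈ B, g y (y c) := by
      intro y
      rw [Finset.mul_sum, Finset.sum_mul]
      refine Finset.sum_congr rfl fun v _ => ?_
      rw [Finset.prod_insert haB, hH _ _ _ haA, hg _ _ _ _ haA, Function.update_self]
      have : ∏ c ∈ B, g (Function.update y a v) (Function.update y a v c)
          = ∏ c ∈ B, g y (y c) := by
        refine Finset.prod_congr rfl fun c hc => ?_
        rw [hg _ _ _ _ haA, Function.update_of_ne (by rintro rfl; exact haB hc)]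
      rw [this]; ring
    simp only [h1]
    rw [ih hBA (fun y => H y * ∑ v, κ a v * g y v)]
    · congr 1
      funext y
      rw [Finset.prod_insert haB]; ring
    · intro y c v hc
      simp only [hH y c v hc, hg y c v _ hc]

/-- If, whatever set of fewer than `M` vertices is excluded, `ρ` bounds the mean of `h` at the
new position of each agent, then the product of `h` over the set of vertices visited by the agents
of `A` has mean at most `ρ ^ |A|`. -/
lemma prodExp_prod_image_le (hκ : IsKernel κ) {h : V → ℝ} (h0 : ∀ u, 0 ≤ h u) {ρ : ℝ}
    (hρ0 : 0 ≤ ρ) (M : ℕ)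
    (hρ : ∀ a, ∀ O : Finset V, O.card < M → ∑ v, κ a v * (if v ∈ O then 1 else h v) ≤ ρ)
    (A : Finset α) (hA : A.card ≤ M) :
    prodExp κ (fun y => ∏ u ∈ A.image y, h u) ≤ ρ ^ A.card := by
  induction A using Finset.induction_on with
  | empty => simp [prodExp_const hκ]
  | insert b A hb ih =>
    rw [Finset.card_insert_of_notMem hb] at hA ⊢
    rw [prodExp_resample hκ b]
    have h1 : ∀ y : α → V, (∑ v, κ b v * ∏ u ∈ (insert b A).image (Function.update y b v), h u)
        ≤ ρ * ∏ u ∈ A.image y, h u := by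
      intro y
      have himg : ∀ v, A.image (Function.update y b v) = A.image y := by
        intro v
        refine Finset.image_congr fun c hc => ?_
        exact Function.update_of_ne (by rintro rfl; exact hb hc) _ _
      have h2 : ∀ v, ∏ u ∈ (insert b A).image (Function.update y b v), h u
          = (if v ∈ A.image y then 1 else h v) * ∏ u ∈ A.image y, h u := by
        intro v
        rw [Finset.image_insert, himg, Function.update_self]
        split_ifs with hv
        · rw [Finset.insert_eq_of_mem hv, one_mul]
        · rw [Finset.prod_insert hv]
      simp only [h2, ← mul_assoc, ← Finset.sum_mul]
      refine mul_le_mul_of_nonneg_right (hρ b _ ?_) (Finset.prod_nonneg fun u _ => h0 u)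
      exact lt_of_le_of_lt Finset.card_image_le (by omega)
    refine (prodExp_mono hκ h1).trans ?_
    rw [prodExp_const_mul, pow_succ']
    exact mul_le_mul_of_nonneg_left (ih (by omega)) hρ0

lemma card_spread (A : Finset α) (y : α → V) :
    (spread A y).card = A.card + (Aᶜ.filter fun a => ∃ b ∈ A, y a = y b).card := by
  rw [← Finset.card_union_of_disjoint]
  · congr 1
    ext a
    by_cases ha : a ∈ A <;> simp [spread, ha]
  · rw [Finset.disjoint_left]
    intro a ha
    simp [ha]

/-- The Laplace transform of the number of newly green agents is bounded by a product over the
vertices visited by green agents. -/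
lemma prodExp_laplace_le (hκ : IsKernel κ) (A : Finset α) {θ : ℝ} (hθ : 0 ≤ θ) :
    prodExp κ (fun y => Real.exp (-θ * (spread A y).card))
      ≤ Real.exp (-θ * A.card) * prodExp κ (fun y => ∏ u ∈ A.image y,
          Real.exp (-((1 - Real.exp (-θ)) * ∑ a ∈ Aᶜ, κ a u))) := by
  set s := 1 - Real.exp (-θ) with hs
  have hs0 : 0 ≤ s := by
    have : Real.exp (-θ) ≤ 1 := Real.exp_le_one_iff.2 (by linarith)
    linarith
  have hs1 : s ≤ 1 := by have := Real.exp_pos (-θ); linarith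
  let g : (α → V) → V → ℝ := fun y u => 1 - s * if u ∈ A.image y then 1 else 0
  have hg : ∀ y a v u, a ∉ A → g (Function.update y a v) u = g y u := by
    intro y a v u ha
    have : A.image (Function.update y a v) = A.image y := by
      refine Finset.image_congr fun c hc => ?_
      exact Function.update_of_ne (by rintro rfl; exact ha hc) _ _
    simp only [g, this]
  have h1 : ∀ y : α → V, Real.exp (-θ * (spread A y).card)
      = Real.exp (-θ * A.card) * ∏ a ∈ Aᶜ, g y (y a) := by
    intro y
    rw [card_spread, Nat.cast_add, mul_add, Real.exp_add, Finset.card_filter, Nat.cast_sum,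
      Finset.mul_sum, Real.exp_sum]
    congr 1
    refine Finset.prod_congr rfl fun a _ => ?_
    have hiff : y a ∈ A.image y ↔ ∃ b ∈ A, y a = y b := by
      simp only [Finset.mem_image, eq_comm]
    by_cases hP : ∃ b ∈ A, y a = y b
    · simp only [g, if_pos (hiff.2 hP), if_pos hP, hs]; simp
    · simp only [g, if_neg (mt hiff.1 hP), if_neg hP]; simp
  simp only [h1]
  rw [prodExp_const_mul]
  refine mul_le_mul_of_nonneg_left ?_ (Real.exp_pos _).le
  have h2 := prodExp_condition hκ A g hg Aᶜ disjoint_compl_left (fun _ => 1) (fun _ _ _ _ => rfl)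
  simp only [one_mul] at h2
  rw [h2]
  refine prodExp_mono hκ fun y => ?_
  have h3 : ∏ u ∈ A.image y, Real.exp (-(s * ∑ a ∈ Aᶜ, κ a u))
      = ∏ a ∈ Aᶜ, Real.exp (-(s * ∑ u ∈ A.image y, κ a u)) := by
    rw [← Real.exp_sum, ← Real.exp_sum, Finset.sum_neg_distrib, Finset.sum_neg_distrib,
      ← Finset.mul_sum, ← Finset.mul_sum, Finset.sum_comm]
  rw [h3]
  have h4 : ∀ a, ∑ v, κ a v * g y v = 1 - s * ∑ u ∈ A.image y, κ a u := by
    intro a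
    simp only [g, mul_sub, mul_one, Finset.sum_sub_distrib, hκ.sum_one]
    congr 1
    rw [Finset.mul_sum, ← Finset.sum_subset (Finset.subset_univ (A.image y))]
    · exact Finset.sum_congr rfl fun u hu => by rw [if_pos hu]; ring
    · intro u _ hu
      rw [if_neg hu]; ring
  refine Finset.prod_le_prod (fun a _ => ?_) fun a _ => ?_
  · refine Finset.sum_nonneg fun v _ => mul_nonneg (hκ.nonneg a v) ?_
    simp only [g]
    split_ifs <;> linarith
  · rw [h4]
    have := Real.add_one_le_exp (-(s * ∑ u ∈ A.image y, κ a u))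
    linarith

end Laplace

section MoveKernel

variable {α V : Type*} [Fintype α] [DecidableEq α] [Fintype V] [DecidableEq V]

/-- An agent at `x a` moves to each other vertex with weight `r`. -/
noncomputable def moveKernel (r : ℝ) (x : α → V) (a : α) (v : V) : ℝ := if v = x a then 0 else r

lemma moveKernel_le {r : ℝ} (hr0 : 0 ≤ r) (x : α → V) (a : α) (v : V) :
    moveKernel r x a v ≤ r := by
  unfold moveKernel; split_ifs <;> simp [hr0]

lemma isKernel_moveKernel {r : ℝ} (hr0 : 0 ≤ r) (hr : r * ((Fintype.card V : ℝ) - 1) = 1)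
    (x : α → V) : IsKernel (moveKernel r x) where
  nonneg a v := by unfold moveKernel; split_ifs <;> simp [hr0]
  sum_one a := by
    have h : ∀ v, moveKernel r x a v = r - if v = x a then r else 0 := by
      intro v; unfold moveKernel; split_ifs <;> simp
    simp only [h, Finset.sum_sub_distrib, Finset.sum_ite_eq', Finset.mem_univ, if_true,
      Finset.sum_const, Finset.card_univ, nsmul_eq_mul]
    linarith

lemma exp_neg_one_sub_mul_le {t z : ℝ} (ht0 : 0 ≤ t) (ht1 : t ≤ 1) :
    Real.exp (-((1 - t) * z)) ≤ t + (1 - t) * Real.exp (-z) := by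
  have h := convexOn_exp.2 (Set.mem_univ (0 : ℝ)) (Set.mem_univ (-z)) ht0
    (sub_nonneg.2 ht1) (by ring)
  simp only [smul_eq_mul, mul_zero, zero_add, Real.exp_zero, mul_one] at h
  rwa [mul_neg] at h

/-- The fraction of the agents of `B` located at `u`. -/
noncomputable def frac (x : α → V) (B : Finset α) (u : V) : ℝ :=
  ((B.filter fun b => x b = u).card : ℝ) / B.card

lemma frac_nonneg (x : α → V) (B : Finset α) (u : V) : 0 ≤ frac x B u := by
  unfold frac; positivity

lemma frac_le_one (x : α → V) (B : Finset α) (u : V) : frac x B u ≤ 1 :=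
  div_le_one_of_le₀ (by exact_mod_cast Finset.card_filter_le _ _) (by positivity)

lemma sum_frac_le (x : α → V) (B : Finset α) : ∑ u, frac x B u ≤ 1 := by
  simp only [frac, ← Finset.sum_div]
  refine div_le_one_of_le₀ ?_ (by positivity)
  rw [← Nat.cast_sum, ← Finset.card_eq_sum_card_fiberwise (fun b _ => Finset.mem_univ (x b))]

lemma sum_mul_frac_le {κ : α → V → ℝ} {r : ℝ} (hr0 : 0 ≤ r) (hr : ∀ a v, κ a v ≤ r)
    (x : α → V) (B : Finset α) (a : α) : ∑ u, κ a u * frac x B u ≤ r := by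
  calc _ ≤ ∑ u, r * frac x B u :=
        Finset.sum_le_sum fun u _ => mul_le_mul_of_nonneg_right (hr a u) (frac_nonneg x B u)
    _ ≤ _ := by
        rw [← Finset.mul_sum]
        exact mul_le_of_le_one_right hr0 (sum_frac_le x B)

lemma sum_moveKernel (r : ℝ) (x : α → V) (B : Finset α) (u : V) :
    ∑ b ∈ B, moveKernel r x b u = (1 - frac x B u) * (r * B.card) := by
  have h : ∀ b, moveKernel r x b u = r - r * if x b = u then 1 else 0 := by
    intro b; unfold moveKernel
    by_cases hb : x b = u
    · simp [hb]
    · simp [hb, Ne.symm hb]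
  simp only [h, Finset.sum_sub_distrib, ← Finset.mul_sum, Finset.sum_const, nsmul_eq_mul, frac]
  rw [Finset.card_filter, Nat.cast_sum]
  simp only [Nat.cast_ite, Nat.cast_one, Nat.cast_zero]
  rcases Finset.eq_empty_or_nonempty B with rfl | hB
  · simp
  · have : (B.card : ℝ) ≠ 0 := by exact_mod_cast hB.card_pos.ne'
    field_simp

/-- One-round bound on the expected number of white agents. -/
lemma prodExp_white_le {r : ℝ} (hr0 : 0 ≤ r) (hr : r * ((Fintype.card V : ℝ) - 1) = 1)
    (x : α → V) (A : Finset α) :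
    prodExp (moveKernel r x) (fun y => ((spread A y)ᶜ.card : ℝ))
      ≤ (Real.exp (-(r * A.card)) + r) * (Aᶜ.card : ℝ) := by
  have hκ := isKernel_moveKernel hr0 hr x
  rw [prodExp_white hκ, mul_comm, ← nsmul_eq_mul, ← Finset.sum_const]
  refine Finset.sum_le_sum fun a _ => ?_
  set E := Real.exp (-(r * A.card)) with hE
  have hE0 : 0 ≤ E := (Real.exp_pos _).le
  have hE1 : ∀ u, emptyProb (moveKernel r x) A u ≤ E + frac x A u := by
    intro u
    calc emptyProb (moveKernel r x) A u ≤ ∏ b ∈ A, Real.exp (-moveKernel r x b u) := by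
          refine Finset.prod_le_prod (fun b _ => ?_) fun b _ => ?_
          · linarith [hκ.le_one b u]
          · linarith [Real.add_one_le_exp (-moveKernel r x b u)]
      _ = Real.exp (-((1 - frac x A u) * (r * A.card))) := by
          rw [← Real.exp_sum, Finset.sum_neg_distrib, sum_moveKernel]
      _ ≤ frac x A u + (1 - frac x A u) * E :=
          exp_neg_one_sub_mul_le (frac_nonneg x A u) (frac_le_one x A u)
      _ ≤ _ := by nlinarith [frac_nonneg x A u]
  calc avoidProb (moveKernel r x) A a ≤ ∑ u, moveKernel r x a u * (E + frac x A u) :=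
        Finset.sum_le_sum fun u _ => mul_le_mul_of_nonneg_left (hE1 u) (hκ.nonneg a u)
    _ = E + ∑ u, moveKernel r x a u * frac x A u := by
        simp only [mul_add, Finset.sum_add_distrib, ← Finset.sum_mul, hκ.sum_one, one_mul]
    _ ≤ _ := by linarith [sum_mul_frac_le hr0 (moveKernel_le hr0 x) x A a]

/-- The map by which the Laplace parameter grows in one round. -/
noncomputable def laplaceStep (d c θ : ℝ) : ℝ :=
  θ + (1 - d) * (1 - Real.exp (-((1 - Real.exp (-θ)) * c)))

/-- One-round bound on the Laplace transform of the number of green agents. -/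
lemma prodExp_exp_green_le {r : ℝ} (hr0 : 0 ≤ r) (hr : r * ((Fintype.card V : ℝ) - 1) = 1)
    (x : α → V) (A : Finset α) {d c θ : ℝ} (hθ : 0 ≤ θ) (hd : r * A.card ≤ d)
    (hd1 : d ≤ 1) (hc : c ≤ r * Aᶜ.card) :
    prodExp (moveKernel r x) (fun y => Real.exp (-θ * (spread A y).card))
      ≤ Real.exp (-laplaceStep d c θ * A.card) := by
  have hκ := isKernel_moveKernel hr0 hr x
  refine (prodExp_laplace_le hκ A hθ).trans ?_
  rw [laplaceStep, neg_add, add_mul, Real.exp_add]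
  refine mul_le_mul_of_nonneg_left ?_ (Real.exp_pos _).le
  set s := 1 - Real.exp (-θ) with hs
  have hs0 : 0 ≤ s := by
    have : Real.exp (-θ) ≤ 1 := Real.exp_le_one_iff.2 (by linarith)
    linarith
  set z := s * (r * Aᶜ.card) with hz
  have hz0 : 0 ≤ z := by positivity
  set p := 1 - Real.exp (-z) with hp
  have hp0 : 0 ≤ p := by
    have : Real.exp (-z) ≤ 1 := Real.exp_le_one_iff.2 (by linarith)
    linarith
  have hpc : 1 - Real.exp (-(s * c)) ≤ p := by
    have : Real.exp (-z) ≤ Real.exp (-(s * c)) :=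
      Real.exp_le_exp.2 (neg_le_neg (mul_le_mul_of_nonneg_left hc hs0))
    linarith
  set ρ := Real.exp (-((1 - r * A.card) * p)) with hρ
  have hmain : prodExp (moveKernel r x) (fun y => ∏ u ∈ A.image y,
      Real.exp (-(s * ∑ a ∈ Aᶜ, moveKernel r x a u))) ≤ ρ ^ A.card := by
    refine prodExp_prod_image_le hκ (fun u => (Real.exp_pos _).le) (Real.exp_pos _).le A.card ?_
      A le_rfl
    intro b O hO
    have h1 : ∀ v, (if v ∈ O then 1 else Real.exp (-(s * ∑ a ∈ Aᶜ, moveKernel r x a v)))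
        ≤ 1 - p * (1 - frac x Aᶜ v - if v ∈ O then 1 else 0) := by
      intro v
      have hf0 := frac_nonneg x Aᶜ v
      split_ifs
      · nlinarith
      · rw [sum_moveKernel, mul_left_comm, ← hz]
        have := exp_neg_one_sub_mul_le (z := z) hf0 (frac_le_one x Aᶜ v)
        have h2 : Real.exp (-z) = 1 - p := by rw [hp]; ring
        rw [h2] at this
        linarith
    have hO' : ∑ v, moveKernel r x b v * (if v ∈ O then 1 else 0) ≤ r * O.card := by
      simp only [mul_ite, mul_one, mul_zero, Finset.sum_ite_mem, Finset.univ_inter]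
      calc _ ≤ ∑ v ∈ O, r := Finset.sum_le_sum fun v _ => moveKernel_le hr0 x b v
        _ = _ := by rw [Finset.sum_const, nsmul_eq_mul, mul_comm]
    have hO1 : r * O.card + r ≤ r * A.card := by
      have : (O.card : ℝ) + 1 ≤ A.card := by exact_mod_cast hO
      nlinarith
    calc _ ≤ ∑ v, moveKernel r x b v * (1 - p * (1 - frac x Aᶜ v - if v ∈ O then 1 else 0)) :=
          Finset.sum_le_sum fun v _ => mul_le_mul_of_nonneg_left (h1 v) (hκ.nonneg b v)
      _ = (1 - p) + p * ∑ v, moveKernel r x b v * frac x Aᶜ v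
            + p * ∑ v, moveKernel r x b v * (if v ∈ O then 1 else 0) := by
          rw [← mul_one (1 - p), ← hκ.sum_one b, Finset.mul_sum, Finset.mul_sum, Finset.mul_sum,
            ← Finset.sum_add_distrib, ← Finset.sum_add_distrib, hκ.sum_one b]
          exact Finset.sum_congr rfl fun v _ => by ring
      _ ≤ (1 - p) + p * r + p * (r * O.card) := by
          have := sum_mul_frac_le hr0 (moveKernel_le hr0 x) x Aᶜ b
          gcongr
      _ ≤ 1 - (1 - r * A.card) * p := by nlinarith
      _ ≤ ρ := by linarith [Real.add_one_le_exp (-((1 - r * A.card) * p))]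
  refine hmain.trans ?_
  rw [hρ, ← Real.exp_nat_mul]
  refine Real.exp_le_exp.2 ?_
  have h2 : (1 - d) * (1 - Real.exp (-(s * c))) ≤ (1 - r * A.card) * p :=
    (mul_le_mul_of_nonneg_left hpc (by linarith)).trans
      (mul_le_mul_of_nonneg_right (by linarith) hp0)
  have hA0 : (0 : ℝ) ≤ A.card := by positivity
  nlinarith

end MoveKernel

section Iteration

variable {α V : Type*} [Fintype α] [DecidableEq α] [Fintype V] [DecidableEq V]

/-- The one-round transition operator on functions of the positions and the set of green agents. -/
noncomputable def step (r : ℝ) (f : (α → V) → Finset α → ℝ) (x : α → V) (A : Finset α) : ℝ :=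
  prodExp (moveKernel r x) fun y => f y (spread A y)

variable {r : ℝ}

lemma step_mono (hr0 : 0 ≤ r) (hr : r * ((Fintype.card V : ℝ) - 1) = 1)
    {f g : (α → V) → Finset α → ℝ} (x : α → V) {A : Finset α}
    (h : ∀ y B, A ⊆ B → f y B ≤ g y B) : step r f x A ≤ step r g x A :=
  prodExp_mono (isKernel_moveKernel hr0 hr x) fun y => h y _ (subset_spread A y)

lemma iter_mono (hr0 : 0 ≤ r) (hr : r * ((Fintype.card V : ℝ) - 1) = 1)
    {f g : (α → V) → Finset α → ℝ} (T : ℕ) (x : α → V) {A : Finset α}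
    (h : ∀ y B, A ⊆ B → f y B ≤ g y B) : (step r)^[T] f x A ≤ (step r)^[T] g x A := by
  induction T generalizing x A with
  | zero => exact h x A subset_rfl
  | succ T ih =>
    rw [Function.iterate_succ_apply', Function.iterate_succ_apply']
    exact step_mono hr0 hr x fun y B hB => ih y fun z C hC => h z C (hB.trans hC)

lemma iter_const (hr0 : 0 ≤ r) (hr : r * ((Fintype.card V : ℝ) - 1) = 1) (T : ℕ) (b : ℝ)
    (x : α → V) (A : Finset α) : (step r)^[T] (fun _ _ => b) x A = b := by
  induction T generalizing x A with
  | zero => rfl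
  | succ T ih =>
    rw [Function.iterate_succ_apply', step]
    simp only [ih, prodExp_const (isKernel_moveKernel hr0 hr x)]

lemma iter_add (T : ℕ) (f g : (α → V) → Finset α → ℝ) (x : α → V) (A : Finset α) :
    (step r)^[T] (fun y B => f y B + g y B) x A
      = (step r)^[T] f x A + (step r)^[T] g x A := by
  induction T generalizing x A with
  | zero => rfl
  | succ T ih =>
    simp only [Function.iterate_succ_apply', step, ih, prodExp_add]

lemma iter_const_mul (T : ℕ) (b : ℝ) (f : (α → V) → Finset α → ℝ) (x : α → V) (A : Finset α) :
    (step r)^[T] (fun y B => b * f y B) x A = b * (step r)^[T] f x A := by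
  induction T generalizing x A with
  | zero => rfl
  | succ T ih =>
    simp only [Function.iterate_succ_apply', step, ih, prodExp_const_mul]

/-- Indicator that all agents are green. -/
noncomputable def allGreen (_ : α → V) (A : Finset α) : ℝ := if A = Finset.univ then 1 else 0

lemma iter_white_le (hr0 : 0 ≤ r) (hr : r * ((Fintype.card V : ℝ) - 1) = 1) (T : ℕ) {g : ℝ}
    (x : α → V) {A : Finset α} (hg : g ≤ A.card) :
    (step r)^[T] (fun _ B => (Bᶜ.card : ℝ)) x A
      ≤ (Real.exp (-(r * g)) + r) ^ T * (Aᶜ.card : ℝ) := by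
  induction T generalizing x A with
  | zero => simp
  | succ T ih =>
    rw [Function.iterate_succ_apply']
    have hE : 0 ≤ Real.exp (-(r * g)) + r := add_nonneg (Real.exp_pos _).le hr0
    calc _ ≤ step r (fun _ B => (Real.exp (-(r * g)) + r) ^ T * (Bᶜ.card : ℝ)) x A := by
          refine step_mono hr0 hr x fun y B hB => ih y ?_
          exact hg.trans (by exact_mod_cast Finset.card_le_card hB)
      _ = (Real.exp (-(r * g)) + r) ^ T * step r (fun _ B => (Bᶜ.card : ℝ)) x A := by
          simp only [step, prodExp_const_mul]
      _ ≤ (Real.exp (-(r * g)) + r) ^ T * ((Real.exp (-(r * g)) + r) * (Aᶜ.card : ℝ)) := by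
          refine mul_le_mul_of_nonneg_left ?_ (pow_nonneg hE T)
          refine (prodExp_white_le hr0 hr x A).trans ?_
          gcongr
      _ = _ := by ring

lemma iter_green_le (hr0 : 0 ≤ r) (hr1 : r ≤ 1) (hr : r * ((Fintype.card V : ℝ) - 1) = 1) (T : ℕ)
    (x : α → V) (A : Finset α) :
    (step r)^[T] (fun _ B => (B.card : ℝ)) x A ≤ (1 + r * Fintype.card α) ^ T * A.card := by
  induction T generalizing x A with
  | zero => simp
  | succ T ih =>
    rw [Function.iterate_succ_apply']
    calc _ ≤ step r (fun _ B => (1 + r * Fintype.card α) ^ T * (B.card : ℝ)) x A :=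
          step_mono hr0 hr x fun y B _ => ih y B
      _ = (1 + r * Fintype.card α) ^ T * step r (fun _ B => (B.card : ℝ)) x A := by
          simp only [step, prodExp_const_mul]
      _ ≤ (1 + r * Fintype.card α) ^ T * ((1 + r * Fintype.card α) * A.card) := by
          refine mul_le_mul_of_nonneg_left ?_ (by positivity)
          exact prodExp_green_le (isKernel_moveKernel hr0 hr x) hr0 (moveKernel_le hr0 x) hr1 A
      _ = _ := by ring

lemma le_laplaceStep {d c θ : ℝ} (hd1 : d ≤ 1) (hc0 : 0 ≤ c) (hθ : 0 ≤ θ) :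
    θ ≤ laplaceStep d c θ := by
  have h1 : 0 ≤ 1 - Real.exp (-θ) := by
    have : Real.exp (-θ) ≤ 1 := Real.exp_le_one_iff.2 (by linarith)
    linarith
  have h2 : 0 ≤ 1 - Real.exp (-((1 - Real.exp (-θ)) * c)) := by
    have : Real.exp (-((1 - Real.exp (-θ)) * c)) ≤ 1 :=
      Real.exp_le_one_iff.2 (by have := mul_nonneg h1 hc0; linarith)
    linarith
  have := mul_nonneg (sub_nonneg.2 hd1) h2
  unfold laplaceStep
  linarith

lemma iter_laplace_le (hr0 : 0 ≤ r) (hr : r * ((Fintype.card V : ℝ) - 1) = 1) (T : ℕ)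
    {M d c θ : ℝ} (hθ : 0 ≤ θ) (hd : r * M ≤ d) (hd1 : d ≤ 1) (hc0 : 0 ≤ c)
    (hc : c ≤ r * (Fintype.card α - M)) (x : α → V) (A : Finset α) :
    (step r)^[T] (fun _ B => if (B.card : ℝ) ≤ M then Real.exp (-θ * B.card) else 0) x A
      ≤ if (A.card : ℝ) ≤ M then Real.exp (-(laplaceStep d c)^[T] θ * A.card) else 0 := by
  induction T generalizing θ with
  | zero => rfl
  | succ T ih =>
    rw [Function.iterate_succ_apply, Function.iterate_succ_apply]
    refine le_trans (iter_mono hr0 hr T x fun y B _ => ?_)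
      (ih (hθ.trans (le_laplaceStep hd1 hc0 hθ)))
    by_cases hB : (B.card : ℝ) ≤ M
    · rw [if_pos hB]
      refine le_trans (prodExp_mono (isKernel_moveKernel hr0 hr y) fun z => ?_)
        (prodExp_exp_green_le hr0 hr y B hθ ?_ hd1 ?_)
      · dsimp only
        split_ifs
        · exact le_rfl
        · exact (Real.exp_pos _).le
      · exact (mul_le_mul_of_nonneg_left hB hr0).trans hd
      · refine hc.trans (mul_le_mul_of_nonneg_left ?_ hr0)
        rw [← Finset.card_compl_add_card B]
        push_cast
        linarith
    · rw [if_neg hB]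
      have : ∀ z : α → V, (if ((spread B z).card : ℝ) ≤ M then
          Real.exp (-θ * (spread B z).card) else 0) = 0 := by
        intro z
        rw [if_neg]
        intro h
        have h1 : (B.card : ℝ) ≤ (spread B z).card := by
          exact_mod_cast Finset.card_le_card (subset_spread B z)
        exact hB (h1.trans h)
      simp only [step, this]
      rw [prodExp_const (isKernel_moveKernel hr0 hr y)]

lemma iter_allGreen_le (hr0 : 0 ≤ r) (hr1 : r < 1) (hr : r * ((Fintype.card V : ℝ) - 1) = 1)
    {η : ℝ} (hη : 0 < η) (hη1 : η < 1) (T : ℕ) {w : ℝ} (hw : 0 < w) (x : α → V) (A : Finset α)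
    (hA : w ≤ (Aᶜ.card : ℝ)) :
    (step r)^[T] allGreen x A ≤ T * ((1 + r * Fintype.card α) / η ^ 2)
      / (w * ((1 - η) * (1 - r) ^ Fintype.card α) ^ T) := by
  set q := (1 - r) ^ Fintype.card α with hq
  have hq0 : 0 < q := pow_pos (by linarith) _
  have hq1 : q ≤ 1 := pow_le_one₀ (by linarith) (by linarith)
  set D := (1 + r * Fintype.card α) / η ^ 2 with hD
  have hD0 : 0 ≤ D := by positivity
  set σ := (1 - η) * q with hσ
  have hσ0 : 0 < σ := mul_pos (by linarith) hq0
  have hσ1 : σ ≤ 1 := by nlinarith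
  have hone : ∀ (T : ℕ) (y : α → V) B, (step r)^[T] allGreen y B ≤ 1 := by
    intro T y B
    rw [← iter_const hr0 hr T 1 y B]
    refine iter_mono hr0 hr T y fun z C _ => ?_
    unfold allGreen; split_ifs <;> norm_num
  induction T generalizing w x A with
  | zero =>
    have : A ≠ Finset.univ := by
      rintro rfl
      simp at hA; linarith
    simp [allGreen, this]
  | succ T ih =>
    rw [Function.iterate_succ_apply', step]
    have h1 : ∀ y : α → V, (step r)^[T] allGreen y (spread A y)
        ≤ T * D / (w * σ * σ ^ T) + if ((spread A y)ᶜ.card : ℝ) < (1 - η) * q * w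
          then 1 else 0 := by
      intro y
      split_ifs with hy
      · have := hone T y (spread A y)
        have : 0 ≤ T * D / (w * σ * σ ^ T) := by positivity
        linarith
      · rw [add_zero]
        refine ih (mul_pos hw hσ0) y _ ?_
        rw [mul_comm]; exact not_lt.1 hy
    refine (prodExp_mono (isKernel_moveKernel hr0 hr x) h1).trans ?_
    rw [prodExp_add, prodExp_const (isKernel_moveKernel hr0 hr x)]
    have h2 := prodExp_white_small (isKernel_moveKernel hr0 hr x) hr0 (moveKernel_le hr0 x) hr1 hη
      hη1.le hw A hA
    have h3 : (1 + r * Fintype.card α) / (η ^ 2 * q * w) ≤ D / (w * σ ^ (T + 1)) := by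
      rw [hD, div_div, mul_assoc]
      have h4 : σ ^ (T + 1) ≤ q := by
        calc σ ^ (T + 1) ≤ σ := pow_le_of_le_one hσ0.le hσ1 (by omega)
          _ ≤ q := by nlinarith
      have : 0 ≤ r * (Fintype.card α : ℝ) := by positivity
      rw [mul_comm q w]
      gcongr
    have h5 : w * σ * σ ^ T = w * σ ^ (T + 1) := by ring
    rw [h5]
    push_cast
    rw [add_mul, add_div, one_mul]
    linarith

end Iteration

section Trajectories

lemma greenSet_congr {n k : ℕ} {p q : ℕ → Fin k → Fin n} {T : ℕ} (h : ∀ t ≤ T, p t = q t) :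
    greenSet n k p T = greenSet n k q T := by
  induction T with
  | zero => simp only [greenSet, h 0 le_rfl]
  | succ T ih =>
    simp only [greenSet, h (T + 1) le_rfl, ih fun t ht => h t (ht.trans (Nat.le_succ T))]

lemma greenSet_succ (n k : ℕ) (p : ℕ → Fin k → Fin n) (T : ℕ) :
    greenSet n k p (T + 1) = spread (greenSet n k p T) (p (T + 1)) := by
  ext a; simp [greenSet, spread]

/-- The set of initially green agents, before co-located agents are taken into account. -/
def seed (k : ℕ) : Finset (Fin k) := Finset.univ.filter fun b => (b : ℕ) = 0

lemma greenSet_zero (n k : ℕ) (p : ℕ → Fin k → Fin n) :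
    greenSet n k p 0 = spread (seed k) (p 0) := by
  ext a
  simp only [greenSet, spread, seed, Finset.mem_filter, Finset.mem_univ, true_and,
    Finset.mem_union]
  exact ⟨Or.inr, fun h => h.elim (fun h => ⟨a, h, rfl⟩) id⟩

/-- The extension of a trajectory prefix to all times, constant after time `T`. -/
def extend {X : Type*} {T : ℕ} (p : Fin (T + 1) → X) (t : ℕ) : X :=
  p ⟨min t T, Nat.lt_succ_of_le (min_le_right t T)⟩

lemma extend_snoc {X : Type*} {T : ℕ} (p : Fin (T + 1) → X) (y : X) {t : ℕ} (ht : t ≤ T) :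
    extend (Fin.snoc p y : Fin (T + 2) → X) t = extend p t := by
  have h : (⟨min t (T + 1), Nat.lt_succ_of_le (min_le_right t (T + 1))⟩ : Fin (T + 2))
      = Fin.castSucc ⟨min t T, Nat.lt_succ_of_le (min_le_right t T)⟩ := by
    ext; simp; omega
  rw [extend, h, Fin.snoc_castSucc]; rfl

lemma extend_last {X : Type*} {T : ℕ} (p : Fin (T + 1) → X) : extend p T = p (Fin.last T) := by
  simp [extend, Fin.last]

/-- Expectation of a function of the state at the end of round `T`. -/
noncomputable def stateExp (n k T : ℕ) (f : (Fin k → Fin n) → Finset (Fin k) → ℝ) : ℝ :=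
  ∑ p : Fin (T + 1) → Fin k → Fin n,
    prefixProb n k T p * f (p (Fin.last T)) (greenSet n k (extend p) T)

lemma prefixProb_snoc (n k T : ℕ) (p : Fin (T + 1) → Fin k → Fin n) (y : Fin k → Fin n) :
    prefixProb n k (T + 1) (Fin.snoc p y : Fin (T + 2) → Fin k → Fin n)
      = prefixProb n k T p * ∏ a, moveKernel ((n : ℝ) - 1)⁻¹ (p (Fin.last T)) a (y a) := by
  rw [prefixProb, prefixProb, ← Finset.prod_mul_distrib]
  refine Finset.prod_congr rfl fun a _ => ?_
  rw [Fin.prod_univ_castSucc, ← mul_assoc]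
  congr 1
  · congr 1
    refine Finset.prod_congr rfl fun t _ => ?_
    rw [Fin.succ_castSucc, Fin.snoc_castSucc, Fin.snoc_castSucc]
  · rw [Fin.succ_last, Fin.snoc_last, Fin.snoc_castSucc]
    rfl

lemma stateExp_succ (n k T : ℕ) (f : (Fin k → Fin n) → Finset (Fin k) → ℝ) :
    stateExp n k (T + 1) f = stateExp n k T (step ((n : ℝ) - 1)⁻¹ f) := by
  rw [stateExp, ← Fintype.sum_equiv (Fin.snocEquiv fun _ => (Fin k → Fin n)) _ _ fun _ => rfl,
    Fintype.sum_prod_type, Finset.sum_comm]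
  refine Finset.sum_congr rfl fun p _ => ?_
  rw [step, prodExp, Finset.mul_sum]
  refine Finset.sum_congr rfl fun y _ => ?_
  have h : (Fin.snocEquiv fun _ : Fin (T + 2) => (Fin k → Fin n)) (y, p)
      = (Fin.snoc p y : Fin (T + 2) → Fin k → Fin n) := rfl
  rw [h, prefixProb_snoc, Fin.snoc_last, greenSet_succ, extend_last, Fin.snoc_last,
    greenSet_congr fun t ht => extend_snoc p y ht, mul_assoc]

lemma stateExp_eq_iter (n k T : ℕ) (f : (Fin k → Fin n) → Finset (Fin k) → ℝ) :
    stateExp n k T f = stateExp n k 0 ((step ((n : ℝ) - 1)⁻¹)^[T] f) := by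
  induction T generalizing f with
  | zero => rfl
  | succ T ih => rw [stateExp_succ, ih, Function.iterate_succ_apply]

/-- The weights of a uniformly random vertex. -/
noncomputable def uniformKernel (n k : ℕ) (_ : Fin k) (_ : Fin n) : ℝ := (n : ℝ)⁻¹

lemma isKernel_uniformKernel {n : ℕ} (hn : n ≠ 0) (k : ℕ) : IsKernel (uniformKernel n k) where
  nonneg _ _ := by unfold uniformKernel; positivity
  sum_one _ := by
    have : (n : ℝ) ≠ 0 := by exact_mod_cast hn
    simp [uniformKernel, this]

lemma stateExp_zero (n k : ℕ) (f : (Fin k → Fin n) → Finset (Fin k) → ℝ) :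
    stateExp n k 0 f = prodExp (uniformKernel n k) fun x => f x (spread (seed k) x) := by
  rw [stateExp, prodExp]
  refine Fintype.sum_equiv (Equiv.funUnique (Fin 1) (Fin k → Fin n)) _ _ fun p => ?_
  rw [greenSet_zero, extend_last]
  have h : (Equiv.funUnique (Fin 1) (Fin k → Fin n)) p = p (Fin.last 0) := rfl
  rw [h]
  congr 1
  simp [prefixProb, uniformKernel]

lemma probXiLe_eq (n k T : ℕ) :
    probXiLe n k T = prodExp (uniformKernel n k) fun x =>
      (step ((n : ℝ) - 1)⁻¹)^[T] allGreen x (spread (seed k) x) := by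
  rw [← stateExp_zero, ← stateExp_eq_iter, probXiLe, stateExp]
  refine Finset.sum_congr rfl fun p _ => ?_
  rw [allGreen, mul_ite, mul_one, mul_zero]
  rfl

end Trajectories

section FiniteBounds

lemma card_seed {k : ℕ} (hk : k ≠ 0) : (seed k).card = 1 := by
  obtain ⟨k, rfl⟩ := Nat.exists_eq_succ_of_ne_zero hk
  rw [Finset.card_eq_one]
  refine ⟨0, ?_⟩
  ext b
  simp only [seed, Finset.mem_filter, Finset.mem_univ, true_and, Finset.mem_singleton, Fin.ext_iff,
    Fin.val_zero]

lemma inv_sub_one_mul {n : ℕ} (hn : 2 ≤ n) :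
    ((n : ℝ) - 1)⁻¹ * ((Fintype.card (Fin n) : ℝ) - 1) = 1 := by
  have : (2 : ℝ) ≤ n := by exact_mod_cast hn
  rw [Fintype.card_fin]
  exact inv_mul_cancel₀ (by linarith)

lemma inv_sub_one_nonneg {n : ℕ} (hn : 2 ≤ n) : 0 ≤ ((n : ℝ) - 1)⁻¹ := by
  have : (2 : ℝ) ≤ n := by exact_mod_cast hn
  exact inv_nonneg.2 (by linarith)

lemma allGreen_le_one {α V : Type*} [Fintype α] [DecidableEq α] (x : α → V) (A : Finset α) :
    allGreen x A ≤ 1 := by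
  unfold allGreen; split_ifs <;> norm_num

lemma allGreen_nonneg {α V : Type*} [Fintype α] [DecidableEq α] (x : α → V) (A : Finset α) :
    0 ≤ allGreen x A := by
  unfold allGreen; split_ifs <;> norm_num

lemma iter_allGreen_le_one {α V : Type*} [Fintype α] [DecidableEq α] [Fintype V] [DecidableEq V]
    {r : ℝ} (hr0 : 0 ≤ r) (hr : r * ((Fintype.card V : ℝ) - 1) = 1) (T : ℕ) (x : α → V)
    (A : Finset α) : (step r)^[T] allGreen x A ≤ 1 :=
  (iter_mono hr0 hr T x fun y B _ => allGreen_le_one y B).trans_eq (iter_const hr0 hr T 1 x A)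

lemma probXiLe_nonneg {n : ℕ} (hn : 2 ≤ n) (k T : ℕ) : 0 ≤ probXiLe n k T := by
  rw [probXiLe_eq]
  refine prodExp_nonneg (isKernel_uniformKernel (by omega) k) fun x => ?_
  have h := iter_const (inv_sub_one_nonneg hn) (inv_sub_one_mul hn) T 0 x (spread (seed k) x)
  rw [← h]
  exact iter_mono (inv_sub_one_nonneg hn) (inv_sub_one_mul hn) T x fun y B _ => allGreen_nonneg y B

lemma probXiLe_le_one {n : ℕ} (hn : 2 ≤ n) (k T : ℕ) : probXiLe n k T ≤ 1 := by
  rw [probXiLe_eq]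
  have hu := isKernel_uniformKernel (n := n) (by omega) k
  exact (prodExp_mono hu fun x => iter_allGreen_le_one (inv_sub_one_nonneg hn)
    (inv_sub_one_mul hn) T x _).trans_eq (prodExp_const hu 1)

lemma probXiLe_mono {n : ℕ} (hn : 2 ≤ n) (k : ℕ) : Monotone (probXiLe n k) := by
  refine monotone_nat_of_le_succ fun T => ?_
  rw [probXiLe_eq, probXiLe_eq]
  refine prodExp_mono (isKernel_uniformKernel (by omega) k) fun x => ?_
  rw [Function.iterate_succ_apply]
  refine iter_mono (inv_sub_one_nonneg hn) (inv_sub_one_mul hn) T x fun y B _ => ?_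
  have hκ := isKernel_moveKernel (inv_sub_one_nonneg hn) (inv_sub_one_mul hn) y
  by_cases hB : B = Finset.univ
  · subst hB
    rw [step]
    have h : ∀ z : Fin k → Fin n, spread Finset.univ z = Finset.univ := fun z =>
      Finset.univ_subset_iff.1 (subset_spread _ z)
    simp only [h]
    simp [allGreen, prodExp_const hκ]
  · have h0 : allGreen y B = 0 := by simp [allGreen, hB]
    rw [h0]
    exact prodExp_nonneg hκ fun z => allGreen_nonneg _ _

lemma probXiEq_nonneg {n : ℕ} (hn : 2 ≤ n) (k t : ℕ) : 0 ≤ probXiEq n k t := by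
  cases t with
  | zero => exact probXiLe_nonneg hn k 0
  | succ t => exact sub_nonneg.2 (probXiLe_mono hn k (Nat.le_succ t))

lemma sum_probXiEq (n k T : ℕ) : ∑ t ∈ Finset.range (T + 1), probXiEq n k t = probXiLe n k T := by
  induction T with
  | zero => simp [probXiEq]
  | succ T ih => rw [Finset.sum_range_succ, ih, probXiEq]; ring

lemma summable_probXiEq {n : ℕ} (hn : 2 ≤ n) (k : ℕ) : Summable (probXiEq n k) := by
  refine summable_of_sum_range_le (c := 1) (probXiEq_nonneg hn k) fun T => ?_
  cases T with
  | zero => simp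
  | succ T => rw [sum_probXiEq]; exact probXiLe_le_one hn k T

lemma probXiMem_le_one {n : ℕ} (hn : 2 ≤ n) (k : ℕ) (S : Set ℕ) : probXiMem n k S ≤ 1 := by
  have h0 := probXiEq_nonneg hn k
  refine Real.tsum_le_of_sum_range_le (fun t => Set.indicator_nonneg (fun t _ => h0 t) t)
    fun T => ?_
  refine (Finset.sum_le_sum fun t _ => Set.indicator_le_self' (fun t _ => h0 t) t).trans ?_
  cases T with
  | zero => simp
  | succ T => rw [sum_probXiEq]; exact probXiLe_le_one hn k T

lemma sub_le_probXiMem {n : ℕ} (hn : 2 ≤ n) (k : ℕ) {S : Set ℕ} {a b : ℕ}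
    (hS : ∀ t, a < t → t ≤ b → t ∈ S) : probXiLe n k b - probXiLe n k a ≤ probXiMem n k S := by
  have h0 := probXiEq_nonneg hn k
  have hi : ∀ t, 0 ≤ S.indicator (probXiEq n k) t :=
    fun t => Set.indicator_nonneg (fun t _ => h0 t) t
  rcases le_total b a with hab | hab
  · have : 0 ≤ probXiMem n k S := tsum_nonneg hi
    linarith [probXiLe_mono hn k hab]
  · rw [← sum_probXiEq, ← sum_probXiEq,
      ← Finset.sum_range_add_sum_Ico _ (Nat.succ_le_succ hab), add_sub_cancel_left]
    refine le_trans (Finset.sum_le_sum fun t ht => ?_)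
      (((summable_probXiEq hn k).indicator S).sum_le_tsum (Finset.Ico (a + 1) (b + 1))
        fun t _ => hi t)
    rw [Finset.mem_Ico] at ht
    rw [Set.indicator_of_mem (hS t (by omega) (by omega))]

lemma one_sub_probXiLe {n : ℕ} (hn : 2 ≤ n) (k T : ℕ) :
    1 - probXiLe n k T = prodExp (uniformKernel n k) fun x =>
      (step ((n : ℝ) - 1)⁻¹)^[T] (fun y B => 1 - allGreen y B) x (spread (seed k) x) := by
  have hr0 := inv_sub_one_nonneg hn
  have hr := inv_sub_one_mul hn
  rw [probXiLe_eq]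
  have h : ∀ x A, (step ((n : ℝ) - 1)⁻¹)^[T] (fun y B => 1 - allGreen y B) x A
      = 1 - (step ((n : ℝ) - 1)⁻¹)^[T] (allGreen (α := Fin k) (V := Fin n)) x A := by
    intro x A
    have h1 := iter_add (r := ((n : ℝ) - 1)⁻¹) T (fun _ _ => (1 : ℝ))
      (fun y B => (-1) * allGreen (α := Fin k) (V := Fin n) y B) x A
    rw [iter_const_mul, iter_const hr0 hr] at h1
    have h2 : (fun (y : Fin k → Fin n) B => 1 - allGreen y B)
        = fun y B => 1 + (-1) * allGreen y B := by funext y B; ring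
    rw [h2, h1]; ring
  simp only [h]
  rw [prodExp_sub, prodExp_const (isKernel_uniformKernel (by omega) k)]

/-- Lower-tail bound: the number of green agents takes `T₁` rounds to reach half of the agents,
and a white agent then survives for `T₂` further rounds. -/
lemma probXiLe_add_le {n k : ℕ} (hn : 3 ≤ n) (hk : k ≠ 0) {r η : ℝ} (hr : r = ((n : ℝ) - 1)⁻¹)
    (hη : 0 < η) (hη1 : η < 1) (T₁ T₂ : ℕ) :
    probXiLe n k (T₁ + T₂) ≤ 2 / k * (1 + r * k) ^ (T₁ + 1)
      + T₂ * ((1 + r * k) / η ^ 2) / (k / 2 * ((1 - η) * (1 - r) ^ k) ^ T₂) := by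
  have hn2 : 2 ≤ n := by omega
  have hr0 : 0 ≤ r := hr ▸ inv_sub_one_nonneg hn2
  have hrV : r * ((Fintype.card (Fin n) : ℝ) - 1) = 1 := hr ▸ inv_sub_one_mul hn2
  have hnR : (3 : ℝ) ≤ n := by exact_mod_cast hn
  have hr1 : r < 1 := by
    rw [hr]; exact inv_lt_one_of_one_lt₀ (by linarith)
  have hk0 : (0 : ℝ) < k := by exact_mod_cast Nat.pos_of_ne_zero hk
  have hu := isKernel_uniformKernel (n := n) (by omega) k
  set E := T₂ * ((1 + r * k) / η ^ 2) / (k / 2 * ((1 - η) * (1 - r) ^ k) ^ T₂) with hE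
  have hE0 : 0 ≤ E := by
    have : 0 ≤ 1 - r := by linarith
    have : 0 ≤ 1 - η := by linarith
    positivity
  have h1 : ∀ (y : Fin k → Fin n) B, (step r)^[T₂] allGreen y B ≤ 2 / k * (B.card : ℝ) + E := by
    intro y B
    have hBk : (Bᶜ.card : ℝ) + B.card = k := by
      rw [← Nat.cast_add, Finset.card_compl_add_card, Fintype.card_fin]
    by_cases hB : (k : ℝ) / 2 ≤ (Bᶜ.card : ℝ)
    · have := iter_allGreen_le hr0 hr1 hrV hη hη1 T₂ (half_pos hk0) y B hB
      rw [Fintype.card_fin] at this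
      have h0 : 0 ≤ 2 / (k : ℝ) * (B.card : ℝ) := by positivity
      linarith
    · have h2 : 1 ≤ 2 / (k : ℝ) * (B.card : ℝ) := by
        rw [div_mul_eq_mul_div, one_le_div hk0]; linarith
      linarith [iter_allGreen_le_one hr0 hrV T₂ y B]
  have h2 : ∀ x : Fin k → Fin n, (step r)^[T₁ + T₂] allGreen x (spread (seed k) x)
      ≤ 2 / k * (1 + r * k) ^ T₁ * ((spread (seed k) x).card : ℝ) + E := by
    intro x
    rw [Function.iterate_add_apply]
    refine (iter_mono hr0 hrV T₁ x fun y B _ => h1 y B).trans ?_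
    rw [iter_add, iter_const_mul, iter_const hr0 hrV]
    have := iter_green_le hr0 hr1.le hrV T₁ x (spread (seed k) x)
    rw [Fintype.card_fin] at this
    rw [mul_assoc]
    gcongr
  rw [probXiLe_eq, ← hr]
  refine (prodExp_mono hu h2).trans ?_
  rw [prodExp_add, prodExp_const_mul, prodExp_const hu]
  have h3 := prodExp_green_le hu hr0 (fun a v => ?_) hr1.le (seed k)
  · rw [Fintype.card_fin, card_seed hk, Nat.cast_one, mul_one] at h3
    rw [pow_succ, ← mul_assoc]
    gcongr
  · rw [uniformKernel, hr]
    exact inv_anti₀ (by linarith) (by linarith)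

/-- Upper-tail bound: growth of the green agents to a fraction `d` of the vertices, then to all but
a fraction `d` of the agents, then extinction of the white agents. -/
lemma one_sub_probXiLe_le {n k : ℕ} (hn : 3 ≤ n) (hk : k ≠ 0) {r d : ℝ}
    (hr : r = ((n : ℝ) - 1)⁻¹) (hd : 0 < d) (hd1 : d < 1) (hdk : d ≤ r * k) (T₁ T₂ T₃ : ℕ) :
    1 - probXiLe n k (T₁ + (T₂ + T₃)) ≤
      Real.exp 1 * Real.exp (-(laplaceStep d (r * k - d))^[T₁] (r / d))
        + ((Real.exp (-d) + r) ^ T₂ / d + k * (Real.exp (-(r * ((1 - d) * k))) + r) ^ T₃) := by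
  have hn2 : 2 ≤ n := by omega
  have hnR : (3 : ℝ) ≤ n := by exact_mod_cast hn
  have hr0' : 0 < r := hr ▸ inv_pos.2 (by linarith)
  have hr0 : 0 ≤ r := hr0'.le
  have hrV : r * ((Fintype.card (Fin n) : ℝ) - 1) = 1 := hr ▸ inv_sub_one_mul hn2
  have hk0 : (0 : ℝ) < k := by exact_mod_cast Nat.pos_of_ne_zero hk
  have hu := isKernel_uniformKernel (n := n) (by omega) k
  set P₃ := k * (Real.exp (-(r * ((1 - d) * k))) + r) ^ T₃ with hP₃
  set P₂ := (Real.exp (-d) + r) ^ T₂ / d with hP₂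
  have hP₃0 : 0 ≤ P₃ := by positivity
  have hP₂0 : 0 ≤ P₂ := by positivity
  have hcard : ∀ B : Finset (Fin k), (Bᶜ.card : ℝ) + B.card = k := by
    intro B
    rw [← Nat.cast_add, Finset.card_compl_add_card, Fintype.card_fin]
  have hle : ∀ (y : Fin k → Fin n) B, 1 - allGreen y B ≤ (Bᶜ.card : ℝ) := by
    intro y B
    unfold allGreen
    split_ifs with h
    · simp
    · rw [sub_zero, Nat.one_le_cast, Nat.one_le_iff_ne_zero, Finset.card_ne_zero,
        Finset.nonempty_iff_ne_empty]
      exact fun h' => h (Finset.compl_eq_empty_iff B |>.1 h')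
  have hone : ∀ (T : ℕ) (y : Fin k → Fin n) B,
      (step r)^[T] (fun y B => 1 - allGreen y B) y B ≤ 1 := by
    intro T y B
    refine (iter_mono hr0 hrV T y fun z C _ => ?_).trans_eq (iter_const hr0 hrV T 1 y B)
    linarith [allGreen_nonneg z C]
  have h3 : ∀ (y : Fin k → Fin n) B, (step r)^[T₃] (fun y B => 1 - allGreen y B) y B
      ≤ 1 / (d * k) * (Bᶜ.card : ℝ) + P₃ := by
    intro y B
    by_cases hB : (Bᶜ.card : ℝ) ≤ d * k
    · have h4 := (iter_mono hr0 hrV T₃ y fun z C _ => hle z C).trans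
        (iter_white_le hr0 hrV T₃ (g := (1 - d) * k) y (A := B) (by linarith [hcard B]))
      have h5 : (Real.exp (-(r * ((1 - d) * k))) + r) ^ T₃ * (Bᶜ.card : ℝ) ≤ P₃ := by
        rw [hP₃, mul_comm]
        have : (Bᶜ.card : ℝ) ≤ k := by linarith [hcard B, (Nat.cast_nonneg B.card : (0:ℝ) ≤ _)]
        gcongr
      have h6 : 0 ≤ 1 / (d * k) * (Bᶜ.card : ℝ) := by positivity
      linarith
    · have h5 : 1 ≤ 1 / (d * k) * (Bᶜ.card : ℝ) := by
        rw [div_mul_eq_mul_div, one_mul, one_le_div (by positivity)]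
        exact (not_le.1 hB).le
      linarith [hone T₃ y B]
  have hM : r * (d / r) = d := mul_div_cancel₀ d hr0'.ne'
  have hM0 : 0 < d / r := div_pos hd hr0'
  have h2 : ∀ (y : Fin k → Fin n) B, (step r)^[T₂ + T₃] (fun y B => 1 - allGreen y B) y B
      ≤ Real.exp 1 * (if (B.card : ℝ) ≤ d / r then Real.exp (-(r / d) * B.card) else 0)
        + (P₂ + P₃) := by
    intro y B
    split_ifs with hB
    · rw [← Real.exp_add]
      have : 1 ≤ Real.exp (1 + -(r / d) * B.card) := by
        refine Real.one_le_exp ?_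
        have h4 : r / d * B.card ≤ r / d * (d / r) := by gcongr
        have h5 : r / d * (d / r) = 1 := by field_simp
        linarith
      linarith [hone (T₂ + T₃) y B]
    · rw [Function.iterate_add_apply, mul_zero, zero_add]
      refine (iter_mono hr0 hrV T₂ y fun z C _ => h3 z C).trans ?_
      rw [iter_add, iter_const_mul, iter_const hr0 hrV]
      have h4 := iter_white_le hr0 hrV T₂ (g := d / r) y (A := B) (not_le.1 hB).le
      rw [hM] at h4
      have h5 : (Bᶜ.card : ℝ) ≤ k := by linarith [hcard B, (Nat.cast_nonneg B.card : (0:ℝ) ≤ _)]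
      have h6 : 1 / (d * k) * ((Real.exp (-d) + r) ^ T₂ * k) = P₂ := by
        rw [hP₂]; field_simp
      have h7 : 1 / (d * k) * (step r)^[T₂] (fun _ C => (Cᶜ.card : ℝ)) y B ≤ P₂ := by
        rw [← h6]
        refine mul_le_mul_of_nonneg_left (h4.trans ?_) (by positivity)
        gcongr
      linarith
  have hθ : 0 ≤ r / d := by positivity
  have hpos : ∀ (T : ℕ) (θ : ℝ), 0 ≤ θ → 0 ≤ (laplaceStep d (r * k - d))^[T] θ := by
    intro T
    induction T with
    | zero => intro θ h; exact h
    | succ T ih =>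
      intro θ h
      rw [Function.iterate_succ_apply]
      exact ih _ (h.trans (le_laplaceStep hd1.le (by linarith) h))
  have h1 : ∀ x : Fin k → Fin n,
      (step r)^[T₁ + (T₂ + T₃)] (fun y B => 1 - allGreen y B) x (spread (seed k) x)
      ≤ Real.exp 1 * Real.exp (-(laplaceStep d (r * k - d))^[T₁] (r / d)) + (P₂ + P₃) := by
    intro x
    rw [Function.iterate_add_apply]
    refine (iter_mono hr0 hrV T₁ x fun y B _ => h2 y B).trans ?_
    rw [iter_add, iter_const_mul, iter_const hr0 hrV]
    have h4 := iter_laplace_le hr0 hrV T₁ (M := d / r) (d := d) (c := r * k - d) hθ hM.le hd1.le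
      (by linarith) (by rw [Fintype.card_fin, mul_sub, hM]) x (spread (seed k) x)
    refine add_le_add (mul_le_mul_of_nonneg_left (h4.trans ?_) (Real.exp_pos 1).le) le_rfl
    split_ifs
    · refine Real.exp_le_exp.2 ?_
      have h5 : (1 : ℝ) ≤ (spread (seed k) x).card := by
        have := Finset.card_le_card (subset_spread (seed k) x)
        rw [card_seed hk] at this
        exact_mod_cast this
      have h6 := hpos T₁ _ hθ
      nlinarith
    · exact (Real.exp_pos _).le
  rw [one_sub_probXiLe hn2, ← hr]
  exact (prodExp_mono hu h1).trans_eq (prodExp_const hu _)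

end FiniteBounds

section LaplaceIteration

lemma one_sub_exp_neg_ge {x : ℝ} (hx : 0 ≤ x) : x * (1 - x) ≤ 1 - Real.exp (-x) := by
  have h := Real.add_one_le_exp x
  have h1 : Real.exp (-x) * Real.exp x = 1 := by rw [← Real.exp_add]; simp
  have h2 := Real.exp_pos (-x)
  have h3 : Real.exp (-x) * (x + 1) ≤ 1 := by nlinarith
  by_contra hcon
  rw [not_le] at hcon
  nlinarith [mul_nonneg hx (sq_nonneg x), sq_nonneg x]

/-- While small, the Laplace parameter is multiplied by at least `1 + (1 - d) ^ 3 * c` in each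
round; later it still increases. -/
lemma laplaceStep_ge {d c θ : ℝ} (hd : 0 ≤ d) (hd1 : d ≤ 1) (hc : 0 ≤ c) (hθ : 0 ≤ θ) :
    θ + (1 - d) ^ 3 * c * min θ (d / (1 + c)) ≤ laplaceStep d c θ := by
  set m := min θ (d / (1 + c)) with hm
  have hm0 : 0 ≤ m := le_min hθ (by positivity)
  have hmd : m * (1 + c) ≤ d := by
    have : m ≤ d / (1 + c) := min_le_right _ _
    rwa [le_div_iff₀ (by linarith)] at this
  have hm1 : m ≤ d := by nlinarith [mul_nonneg hm0 hc]
  have hmc : m * c ≤ d := by nlinarith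
  have h1 : m * (1 - d) ≤ 1 - Real.exp (-m) :=
    le_trans (mul_le_mul_of_nonneg_left (by linarith) hm0) (one_sub_exp_neg_ge hm0)
  have h2 : 1 - Real.exp (-m) ≤ 1 - Real.exp (-θ) := by
    have : Real.exp (-θ) ≤ Real.exp (-m) := Real.exp_le_exp.2 (neg_le_neg (min_le_left _ _))
    linarith
  have hz0 : 0 ≤ m * (1 - d) * c := mul_nonneg (mul_nonneg hm0 (by linarith)) hc
  have hzd : m * (1 - d) * c ≤ d := by nlinarith [mul_nonneg hm0 hc]
  have h3 : m * (1 - d) * c * (1 - d) ≤ 1 - Real.exp (-(m * (1 - d) * c)) :=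
    le_trans (mul_le_mul_of_nonneg_left (by linarith) hz0) (one_sub_exp_neg_ge hz0)
  have h4 : Real.exp (-((1 - Real.exp (-θ)) * c)) ≤ Real.exp (-(m * (1 - d) * c)) :=
    Real.exp_le_exp.2 (neg_le_neg (mul_le_mul_of_nonneg_right (h1.trans h2) hc))
  have h5 : (1 - d) * (m * (1 - d) * c * (1 - d))
      ≤ (1 - d) * (1 - Real.exp (-((1 - Real.exp (-θ)) * c))) :=
    mul_le_mul_of_nonneg_left (by linarith) (by linarith)
  unfold laplaceStep
  nlinarith

lemma iter_laplaceStep_ge {d c θ : ℝ} (hd : 0 ≤ d) (hd1 : d ≤ 1) (hc : 0 ≤ c) (hθ : 0 ≤ θ)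
    {t : ℕ} (ht : d / (1 + c) ≤ (1 + (1 - d) ^ 3 * c) ^ t * θ) (m : ℕ) :
    m * ((1 - d) ^ 3 * c * (d / (1 + c))) ≤ (laplaceStep d c)^[t + m] θ := by
  have hs : 0 ≤ (1 - d) ^ 3 * c := mul_nonneg (pow_nonneg (by linarith) 3) hc
  have hθs : 0 ≤ d / (1 + c) := by positivity
  set s := (1 - d) ^ 3 * c with hs'
  set b := d / (1 + c) with hb
  have h1 : ∀ t : ℕ, min ((1 + s) ^ t * θ) b ≤ (laplaceStep d c)^[t] θ := by
    intro t
    induction t with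
    | zero => simp
    | succ t ih =>
      rw [Function.iterate_succ_apply']
      have h0 : 0 ≤ (laplaceStep d c)^[t] θ := le_trans (le_min (by positivity) hθs) ih
      have h2 := laplaceStep_ge hd hd1 hc h0
      rw [← hs', ← hb] at h2
      refine le_trans ?_ h2
      rcases le_total b ((laplaceStep d c)^[t] θ) with hcase | hcase
      · rw [min_eq_right hcase]
        have : min ((1 + s) ^ (t + 1) * θ) b ≤ b := min_le_right _ _
        have := mul_nonneg hs hθs
        linarith
      · rw [min_eq_left hcase]
        rcases le_total ((1 + s) ^ t * θ) b with h3 | h3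
        · rw [min_eq_left h3] at ih
          refine (min_le_left _ _).trans ?_
          rw [pow_succ]
          nlinarith
        · rw [min_eq_right h3] at ih
          have : min ((1 + s) ^ (t + 1) * θ) b ≤ b := min_le_right _ _
          have := mul_nonneg hs h0
          linarith
  have h2 : ∀ m : ℕ, b + m * (s * b) ≤ (laplaceStep d c)^[m + t] θ := by
    intro m
    induction m with
    | zero =>
      have := h1 t
      rw [min_eq_right ht] at this
      simpa using this
    | succ m ih =>
      rw [show m + 1 + t = (m + t) + 1 by ring, Function.iterate_succ_apply']
      have h4 : 0 ≤ (m : ℝ) * (s * b) := by positivity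
      have h5 : b ≤ (laplaceStep d c)^[m + t] θ := by linarith
      have h3 := laplaceStep_ge hd hd1 hc (hθs.trans h5)
      rw [← hs', ← hb, min_eq_right h5] at h3
      push_cast
      linarith
  rw [add_comm t m]
  linarith [h2 m]

end LaplaceIteration

section Asymptotics

/-- The iterated-logarithm scales `N = exp ℓ`, `ℓ = exp y` and `u`, all large in terms of `M`. -/
structure Scales (M N ℓ y u : ℝ) : Prop where
  exp_ell : Real.exp ℓ = N
  exp_y : Real.exp y = ℓ
  hundred_le : 100 ≤ M
  le_u : M ≤ u
  u_le : u ≤ y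
  le_ell : M * y ^ 6 ≤ ℓ
  le_N : M * ℓ ^ 10 ≤ N

namespace Scales

variable {M N ℓ y u : ℝ}

lemma u_ge (h : Scales M N ℓ y u) : 100 ≤ u := h.hundred_le.trans h.le_u

lemma y_ge (h : Scales M N ℓ y u) : 100 ≤ y := h.u_ge.trans h.u_le

lemma le_mul_y (h : Scales M N ℓ y u) : M * y ≤ ℓ := by
  refine le_trans ?_ h.le_ell
  have := h.y_ge
  have := h.hundred_le
  gcongr
  exact le_self_pow₀ (by linarith) (by norm_num)

lemma y_le (h : Scales M N ℓ y u) : y ≤ ℓ := by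
  have := h.le_mul_y
  nlinarith [h.hundred_le, h.y_ge]

lemma M_le (h : Scales M N ℓ y u) : M ≤ ℓ := h.le_u.trans (h.u_le.trans h.y_le)

lemma ell_ge (h : Scales M N ℓ y u) : 100 ≤ ℓ := h.y_ge.trans h.y_le

lemma u_le_ell (h : Scales M N ℓ y u) : u ≤ ℓ := h.u_le.trans h.y_le

lemma mul_ell_le (h : Scales M N ℓ y u) : M * ℓ ≤ N := by
  refine le_trans ?_ h.le_N
  have := h.ell_ge
  have := h.hundred_le
  gcongr
  exact le_self_pow₀ (by linarith) (by norm_num)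

lemma N_ge (h : Scales M N ℓ y u) : 10000 ≤ N := by
  nlinarith [h.mul_ell_le, h.hundred_le, h.ell_ge]

lemma u_pow_le (h : Scales M N ℓ y u) : u ^ 6 ≤ ℓ := by
  refine le_trans ?_ h.le_ell
  have h1 : u ^ 6 ≤ y ^ 6 := pow_le_pow_left₀ (by linarith [h.u_ge]) h.u_le 6
  have : 0 ≤ y ^ 6 := by positivity
  nlinarith [h.hundred_le]

lemma inv_u_pos (h : Scales M N ℓ y u) : 0 < u⁻¹ := inv_pos.2 (by linarith [h.u_ge])

lemma inv_u_le (h : Scales M N ℓ y u) : u⁻¹ ≤ 1 / 100 := by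
  rw [one_div]; exact inv_anti₀ (by norm_num) h.u_ge

lemma inv_M_le_inv (h : Scales M N ℓ y u) {a : ℝ} (ha : 0 < a) (hM : 100 / a ≤ M) :
    100 * u⁻¹ ≤ a := by
  have h1 : 100 / a ≤ u := hM.trans h.le_u
  have hu := h.u_ge
  rw [div_le_iff₀ ha] at h1
  rw [← div_eq_mul_inv, div_le_iff₀ (by linarith)]
  linarith

lemma inv_ell_le (h : Scales M N ℓ y u) : ℓ⁻¹ ≤ u⁻¹ :=
  inv_anti₀ (by linarith [h.u_ge]) h.u_le_ell

lemma step_bounds (h : Scales M N ℓ y u) {r : ℝ} (hr : r = (N - 1)⁻¹) :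
    0 < r ∧ N⁻¹ ≤ r ∧ r ≤ 2 * N⁻¹ ∧ M * r ≤ 2 * u⁻¹ := by
  have hN := h.N_ge
  have h1 : r ≤ 2 * N⁻¹ := by
    rw [hr, ← div_eq_mul_inv, le_div_iff₀ (by linarith), inv_mul_le_iff₀ (by linarith)]
    linarith
  refine ⟨hr ▸ inv_pos.2 (by linarith), hr ▸ inv_anti₀ (by linarith) (by linarith), h1, ?_⟩
  have h2 : M * N⁻¹ ≤ ℓ⁻¹ := by
    have hl := h.ell_ge
    rw [← div_eq_mul_inv, div_le_iff₀ (by linarith), ← div_eq_inv_mul,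
      le_div_iff₀ (by linarith)]
    exact h.mul_ell_le
  nlinarith [h.inv_ell_le, h.hundred_le]

lemma log_one_add_le (h : Scales M N ℓ y u) {c : ℝ} (hc0 : 0 ≤ c) (hc : c ≤ ℓ ^ 2) :
    Real.log (1 + c) ≤ 3 * y := by
  rw [Real.log_le_iff_le_exp (by linarith)]
  have h1 : Real.exp (3 * y) = ℓ ^ 3 := by
    rw [← h.exp_y, ← Real.exp_nat_mul]; norm_num
  rw [h1]
  nlinarith [h.ell_ge, sq_nonneg ℓ]

/-- Additive errors polynomial in `log log n` are absorbed by the relative error `u⁻¹`. -/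
lemma slack (h : Scales M N ℓ y u) {ε c : ℝ} (hε : 0 < ε) (hM : 100 / ε ≤ M) (hεc : ε ≤ c)
    (hc : c ≤ ℓ ^ 2) :
    2 * u ^ 3 + 6 * y / ε + 20 ≤ u⁻¹ * ((1 / Real.log (1 + c) + 1 / c) * ℓ) := by
  have hy := h.y_ge
  have hu := h.u_ge
  have hl := h.ell_ge
  have hc0 : 0 < c := hε.trans_le hεc
  have hlog0 : 0 < Real.log (1 + c) := Real.log_pos (by linarith)
  have hlog := h.log_one_add_le hc0.le hc
  have h1 : (y * (3 * y))⁻¹ * ℓ ≤ u⁻¹ * ((1 / Real.log (1 + c) + 1 / c) * ℓ) := by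
    have h2 : (3 * y)⁻¹ ≤ 1 / Real.log (1 + c) + 1 / c := by
      rw [one_div]
      have h3 : (3 * y)⁻¹ ≤ (Real.log (1 + c))⁻¹ := inv_anti₀ hlog0 hlog
      have h4 : 0 ≤ 1 / c := by positivity
      linarith
    have h3 : y⁻¹ ≤ u⁻¹ := inv_anti₀ (by linarith) h.u_le
    rw [mul_inv, mul_assoc]
    exact mul_le_mul h3 (mul_le_mul_of_nonneg_right h2 (by linarith)) (by positivity)
      h.inv_u_pos.le
  refine le_trans ?_ h1
  rw [← div_eq_inv_mul, le_div_iff₀ (by positivity)]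
  refine le_trans ?_ h.le_ell
  have h2 : u ^ 3 ≤ y ^ 3 := pow_le_pow_left₀ (by linarith) h.u_le 3
  have h3 : 6 * y / ε ≤ y ^ 3 * (M * (6/100)) * (1 / 10000) := by
    have : 6 * y / ε = y * (6 / 100 * (100 / ε)) := by ring
    rw [this]
    have h4 : y * (6 / 100 * (100 / ε)) ≤ y * (6 / 100 * M) := by gcongr
    have h5 : y * 10000 ≤ y ^ 3 := by nlinarith [mul_le_mul hy hy (by norm_num) (by linarith)]
    nlinarith [h.hundred_le]
  have h4 : (20 : ℝ) ≤ y ^ 3 := by nlinarith [pow_le_pow_left₀ (by norm_num) hy 3]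
  have hM1 := h.hundred_le
  have h5 : 2 * u ^ 3 + 6 * y / ε + 20 ≤ y ^ 3 * M := by
    nlinarith [pow_pos (by linarith : 0 < y) 3]
  calc (2 * u ^ 3 + 6 * y / ε + 20) * (y * (3 * y)) ≤ (y ^ 3 * M) * (y * (3 * y)) := by gcongr
    _ = M * y ^ 5 * 3 := by ring
    _ ≤ M * y ^ 5 * y := by gcongr; linarith
    _ = M * y ^ 6 := by ring

/-- The growth factor in the first phase, compared with `1 + c`. -/
lemma growth_log_ge (h : Scales M N ℓ y u) {ε c c' : ℝ} (hε : 0 < ε) (hεc : ε ≤ c)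
    (hM : 100 / ε ≤ M) (hc' : c - u⁻¹ ≤ c') :
    Real.log (1 + c) * (1 - 6 / Real.log (1 + ε) * u⁻¹) ≤
      Real.log (1 + (1 - u⁻¹) ^ 3 * c') := by
  have hψ0 := h.inv_u_pos
  have hψ1 := h.inv_u_le
  have hψε := h.inv_M_le_inv hε hM
  set ψ := u⁻¹
  have hlε : 0 < Real.log (1 + ε) := Real.log_pos (by linarith)
  have hlc : Real.log (1 + ε) ≤ Real.log (1 + c) := Real.log_le_log (by linarith) (by linarith)
  have h1 : (1 + c) * (1 - 3 * ψ) ≤ 1 + (1 - ψ) ^ 3 * c' := by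
    have h2 : 1 - 3 * ψ ≤ (1 - ψ) ^ 3 := by nlinarith [pow_pos hψ0 2]
    have h3 : (1 - 3 * ψ) * (c - ψ) ≤ (1 - ψ) ^ 3 * c' :=
      mul_le_mul h2 hc' (by linarith) (by nlinarith)
    nlinarith
  have h2 : Real.log ((1 + c) * (1 - 3 * ψ)) ≤ Real.log (1 + (1 - ψ) ^ 3 * c') :=
    Real.log_le_log (mul_pos (by linarith) (by linarith)) h1
  rw [Real.log_mul (by linarith) (by linarith)] at h2
  have h3 : -(6 * ψ) ≤ Real.log (1 - 3 * ψ) := by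
    have := Real.one_sub_inv_le_log_of_pos (x := 1 - 3 * ψ) (by linarith)
    have h4 : (1 - 3 * ψ)⁻¹ ≤ 1 + 6 * ψ := by
      rw [inv_le_iff_one_le_mul₀ (by linarith)]
      nlinarith
    linarith
  have h4 : 6 * ψ ≤ Real.log (1 + c) * (6 / Real.log (1 + ε) * ψ) := by
    have : Real.log (1 + ε) * (6 / Real.log (1 + ε) * ψ) = 6 * ψ := by field_simp
    rw [← this]
    gcongr
  linarith

lemma upper_time (h : Scales M N ℓ y u) {ε c c' m : ℝ} (hε : 0 < ε) (hεc : ε ≤ c)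
    (hcl : c ≤ ℓ ^ 2) (hM : 100 / ε ≤ M) (hM' : 100 / Real.log (1 + ε) ≤ M)
    (hc' : c - u⁻¹ ≤ c') (hm : m = min c (ℓ / 2)) :
    (⌈ℓ / Real.log (1 + (1 - u⁻¹) ^ 3 * c')⌉₊ + ⌈u ^ 3⌉₊ : ℝ)
        + (⌈u ^ 3⌉₊ + ⌈(ℓ + 3 * y) / ((1 - 2 * u⁻¹) * m)⌉₊) ≤
      (1 + (12 / Real.log (1 + ε) + 5) * u⁻¹) * ((1 / Real.log (1 + c) + 1 / c) * ℓ) := by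
  have hs := h.slack hε hM hεc hcl
  have hg := h.growth_log_ge hε hεc hM hc'
  have hψ0 := h.inv_u_pos
  have hψ1 := h.inv_u_le
  have hu := h.u_ge
  have hy := h.y_ge
  have hl := h.ell_ge
  have hyl := h.y_le
  have hlε : 0 < Real.log (1 + ε) := Real.log_pos (by linarith)
  have hψl := h.inv_M_le_inv hlε hM'
  have hc0 : 0 < c := hε.trans_le hεc
  have hlc : 0 < Real.log (1 + c) := Real.log_pos (by linarith)
  set ψ := u⁻¹
  set Λ := Real.log (1 + (1 - ψ) ^ 3 * c')
  set κ := 6 / Real.log (1 + ε) * ψ with hκ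
  have hκ1 : κ ≤ 1 / 2 := by
    rw [hκ, div_mul_eq_mul_div, div_le_iff₀ hlε]; linarith
  have hκ0 : 0 ≤ κ := by positivity
  have hΛ : 0 < Λ := lt_of_lt_of_le (mul_pos hlc (by linarith)) hg
  have hm0 : 0 < m := by rw [hm]; exact lt_min hc0 (by linarith)
  have e1 : ℓ / Λ ≤ (1 + 2 * κ) * (ℓ / Real.log (1 + c)) := by
    rw [div_le_iff₀ hΛ]
    have : (1 + 2 * κ) * (ℓ / Real.log (1 + c)) * (Real.log (1 + c) * (1 - κ))
        = ℓ * ((1 + 2 * κ) * (1 - κ)) := by field_simp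
    have h2 : ℓ * 1 ≤ ℓ * ((1 + 2 * κ) * (1 - κ)) := by
      gcongr; nlinarith
    have h3 : (1 + 2 * κ) * (ℓ / Real.log (1 + c)) * (Real.log (1 + c) * (1 - κ))
        ≤ (1 + 2 * κ) * (ℓ / Real.log (1 + c)) * Λ := by gcongr
    linarith
  have hinv : 1 / m ≤ 1 / c + 2 / ℓ := by
    rcases min_choice c (ℓ / 2) with h1 | h1 <;> rw [hm, h1]
    · have : 0 ≤ 2 / ℓ := by positivity
      linarith
    · have : 0 ≤ 1 / c := by positivity
      rw [one_div_div]; linarith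
  have e2 : (ℓ + 3 * y) / ((1 - 2 * ψ) * m) ≤ (1 + 4 * ψ) * (ℓ / c) + (6 * y / ε + 15) := by
    have h1 : (ℓ + 3 * y) / ((1 - 2 * ψ) * m) = (1 - 2 * ψ)⁻¹ * ((ℓ + 3 * y) * (1 / m)) := by
      rw [div_eq_mul_inv, mul_inv]; ring
    have h2 : (1 - 2 * ψ)⁻¹ ≤ 1 + 4 * ψ := by
      rw [inv_le_iff_one_le_mul₀ (by linarith)]; nlinarith
    have h3 : (ℓ + 3 * y) * (1 / c + 2 / ℓ) ≤ ℓ / c + 3 * (y / ε) + 8 := by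
      have h4 : (ℓ + 3 * y) * (1 / c + 2 / ℓ) = ℓ / c + 2 + 3 * (y / c) + 6 * (y / ℓ) := by
        field_simp; ring
      have h5 : y / c ≤ y / ε := by gcongr
      have h6 : y / ℓ ≤ 1 := (div_le_one (by linarith)).2 hyl
      linarith
    have h4 : 0 < y / ε := by positivity
    rw [h1]
    calc (1 - 2 * ψ)⁻¹ * ((ℓ + 3 * y) * (1 / m))
        ≤ (1 + 4 * ψ) * ((ℓ + 3 * y) * (1 / c + 2 / ℓ)) := by gcongr
      _ ≤ (1 + 4 * ψ) * (ℓ / c + 3 * (y / ε) + 8) := by gcongr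
      _ ≤ _ := by
        rw [mul_div_assoc]
        nlinarith
  have c1 := Nat.ceil_lt_add_one (a := ℓ / Λ) (by positivity)
  have c2 := Nat.ceil_lt_add_one (a := u ^ 3) (by positivity)
  have c3 := Nat.ceil_lt_add_one (a := (ℓ + 3 * y) / ((1 - 2 * ψ) * m))
    (div_nonneg (by linarith) (mul_nonneg (by linarith) hm0.le))
  have h1 : (1 + (12 / Real.log (1 + ε) + 5) * ψ) * ((1 / Real.log (1 + c) + 1 / c) * ℓ)
      = (1 + 2 * κ + 4 * ψ) * (ℓ / Real.log (1 + c)) + (1 + 2 * κ + 4 * ψ) * (ℓ / c)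
        + ψ * ((1 / Real.log (1 + c) + 1 / c) * ℓ) := by
    rw [hκ]; ring
  have h2 : 0 ≤ ψ * (ℓ / Real.log (1 + c)) := by positivity
  have h3 : 0 ≤ κ * (ℓ / c) := by positivity
  rw [h1]
  linarith

lemma exp_half_le (h : Scales M N ℓ y u) {a : ℝ} (ha : 0 < a) (hM : 100 / a ≤ M) :
    2 * Real.exp (-(ℓ / 2)) ≤ u⁻¹ * a := by
  have hl := h.ell_ge
  have h1 := Real.quadratic_le_exp_of_nonneg (x := ℓ / 2) (by linarith)
  have h2 : Real.exp (-(ℓ / 2)) ≤ 8 * (ℓ⁻¹ * ℓ⁻¹) := by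
    rw [Real.exp_neg, inv_le_iff_one_le_mul₀ (Real.exp_pos _)]
    have : 8 * (ℓ⁻¹ * ℓ⁻¹) * (ℓ ^ 2 / 8) ≤ 8 * (ℓ⁻¹ * ℓ⁻¹) * Real.exp (ℓ / 2) := by
      gcongr; nlinarith
    refine le_trans (le_of_eq ?_) this
    field_simp
  have h3 : ℓ⁻¹ * 100 ≤ a := by
    have h4 : 100 / a ≤ ℓ := hM.trans h.M_le
    rw [div_le_iff₀ ha] at h4
    rw [inv_mul_le_iff₀ (by linarith)]
    exact h4
  have h5 : ℓ⁻¹ * (ℓ⁻¹ * 100) ≤ u⁻¹ * a :=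
    mul_le_mul h.inv_ell_le h3 (by positivity) h.inv_u_pos.le
  have h6 : 0 < ℓ⁻¹ * ℓ⁻¹ := by positivity
  linarith

lemma lower_time (h : Scales M N ℓ y u) {ε c c' r : ℝ} (hε : 0 < ε) (hεc : ε ≤ c)
    (hcl : c ≤ ℓ ^ 2) (hM : 100 / ε ≤ M) (hM' : 100 / Real.log (1 + ε) ≤ M)
    (hr : r = (N - 1)⁻¹) (hc' : c' = c * (1 + r)) :
    (1 - 3 * u⁻¹) * ((1 / Real.log (1 + c) + 1 / c) * ℓ) ≤
      ⌊(1 - u⁻¹) * ℓ / Real.log (1 + c')⌋₊ + ⌊(1 - u⁻¹) * ℓ / c⌋₊ + 1 := by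
  have hs := h.slack hε hM hεc hcl
  obtain ⟨hr0, -, -, hMr⟩ := h.step_bounds hr
  have hψ0 := h.inv_u_pos
  have hψ1 := h.inv_u_le
  have hu := h.u_ge
  have hy := h.y_ge
  have hl := h.ell_ge
  have hlε : 0 < Real.log (1 + ε) := Real.log_pos (by linarith)
  have hc0 : 0 < c := hε.trans_le hεc
  have hlc : 0 < Real.log (1 + c) := Real.log_pos (by linarith)
  have hlc1 : Real.log (1 + ε) ≤ Real.log (1 + c) := Real.log_le_log (by linarith) (by linarith)
  set ψ := u⁻¹
  have hc'0 : 0 < c' := by rw [hc']; positivity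
  have hlc' : 0 < Real.log (1 + c') := Real.log_pos (by linarith)
  have h1 : Real.log (1 + c') ≤ (1 + ψ) * Real.log (1 + c) := by
    have h2 : Real.log (1 + c') ≤ Real.log ((1 + c) * (1 + r)) :=
      Real.log_le_log (by linarith) (by rw [hc']; nlinarith)
    rw [Real.log_mul (by linarith) (by linarith)] at h2
    have h3 := Real.log_le_sub_one_of_pos (x := 1 + r) (by linarith)
    have h4 : r ≤ ψ * Real.log (1 + ε) := by
      have h5 : 100 / Real.log (1 + ε) * r ≤ 2 * ψ :=
        (mul_le_mul_of_nonneg_right hM' hr0.le).trans hMr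
      rw [div_mul_eq_mul_div, div_le_iff₀ hlε] at h5
      nlinarith
    have h5 : ψ * Real.log (1 + ε) ≤ ψ * Real.log (1 + c) := by gcongr
    linarith
  have h2 : (1 - 2 * ψ) * (ℓ / Real.log (1 + c)) ≤ (1 - ψ) * ℓ / Real.log (1 + c') := by
    rw [le_div_iff₀ hlc']
    have h3 : (1 - 2 * ψ) * (ℓ / Real.log (1 + c)) * Real.log (1 + c') ≤
        (1 - 2 * ψ) * (ℓ / Real.log (1 + c)) * ((1 + ψ) * Real.log (1 + c)) := by
      have : 0 ≤ 1 - 2 * ψ := by linarith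
      gcongr
    have h4 : (1 - 2 * ψ) * (ℓ / Real.log (1 + c)) * ((1 + ψ) * Real.log (1 + c))
        = (1 - 2 * ψ) * (1 + ψ) * ℓ := by field_simp
    have h5 : (1 - 2 * ψ) * (1 + ψ) * ℓ ≤ (1 - ψ) * ℓ := by
      gcongr; nlinarith
    linarith
  have h3 := Nat.lt_floor_add_one ((1 - ψ) * ℓ / Real.log (1 + c'))
  have h4 := Nat.lt_floor_add_one ((1 - ψ) * ℓ / c)
  have h5 : (1 - ψ) * ℓ / c = (1 - ψ) * (ℓ / c) := by ring
  have h6 : (1 - 3 * ψ) * ((1 / Real.log (1 + c) + 1 / c) * ℓ) =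
      (1 - 2 * ψ) * (ℓ / Real.log (1 + c)) + (1 - 2 * ψ) * (ℓ / c)
       - ψ * ((1 / Real.log (1 + c) + 1 / c) * ℓ) := by ring
  have h7 : 0 < ψ * (ℓ / c) := by positivity
  have h8 : 0 ≤ u ^ 3 := by positivity
  have h9 : 0 ≤ 6 * y / ε := by positivity
  rw [h5] at h4 ⊢
  linarith

lemma growth_error (h : Scales M N ℓ y u) {ε c c' r : ℝ} (hε : 0 < ε) (hεc : ε ≤ c)
    (hM : 100 / ε ≤ M) (hr : r = (N - 1)⁻¹) (hc' : c - u⁻¹ ≤ c') :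
    Real.exp 1 * Real.exp (-(laplaceStep u⁻¹ c')^[⌈ℓ / Real.log (1 + (1 - u⁻¹) ^ 3 * c')⌉₊ +
      ⌈u ^ 3⌉₊] (r / u⁻¹)) ≤ Real.exp 1 * (8 * (2 + ε) / ε) * u⁻¹ := by
  obtain ⟨hr0, hrN, -, -⟩ := h.step_bounds hr
  have hψ0 := h.inv_u_pos
  have hψ1 := h.inv_u_le
  have hψε := h.inv_M_le_inv hε hM
  have hu := h.u_ge
  set ψ := u⁻¹ with hψ
  have hc'ε : ε / 2 ≤ c' := by linarith
  have hc'0 : 0 < c' := by linarith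
  set s := (1 - ψ) ^ 3 * c' with hs
  have hψ3 : 1 / 8 ≤ (1 - ψ) ^ 3 := by nlinarith [pow_pos hψ0 2]
  have hs0 : 0 < s := by positivity
  have hΛ : 0 < Real.log (1 + s) := Real.log_pos (by linarith)
  have ht : ψ / (1 + c') ≤ (1 + s) ^ ⌈ℓ / Real.log (1 + s)⌉₊ * (r / ψ) := by
    have h1 : N ≤ (1 + s) ^ ⌈ℓ / Real.log (1 + s)⌉₊ := by
      rw [← h.exp_ell, ← Real.exp_log (by positivity : 0 < (1 + s) ^ ⌈ℓ / Real.log (1 + s)⌉₊),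
        Real.log_pow]
      exact Real.exp_le_exp.2 ((div_le_iff₀ hΛ).1 (Nat.le_ceil _))
    have hN := h.N_ge
    have h2 : 1 ≤ N * (r / ψ) := by
      have h3 : 1 ≤ N * r := by
        have : N * N⁻¹ ≤ N * r := by gcongr
        rwa [mul_inv_cancel₀ (by linarith)] at this
      rw [← mul_div_assoc, le_div_iff₀ hψ0]
      linarith
    have h3 : N * (r / ψ) ≤ (1 + s) ^ ⌈ℓ / Real.log (1 + s)⌉₊ * (r / ψ) := by gcongr
    have h4 : ψ / (1 + c') ≤ 1 := by
      rw [div_le_one (by linarith)]; linarith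
    linarith
  have h1 := iter_laplaceStep_ge hψ0.le (by linarith) hc'0.le (by positivity) ht ⌈u ^ 3⌉₊
  have h2 : u * (ε / (8 * (2 + ε))) ≤ ⌈u ^ 3⌉₊ * ((1 - ψ) ^ 3 * c' * (ψ / (1 + c'))) := by
    have h3 : ε / (2 + ε) ≤ c' / (1 + c') := by
      rw [div_le_div_iff₀ (by linarith) (by linarith)]; nlinarith
    have h4 : u ≤ u ^ 3 * ψ := by
      have h6 : u ^ 3 * ψ = u * u := by rw [hψ]; field_simp
      rw [h6]; nlinarith
    calc u * (ε / (8 * (2 + ε))) = u * (1 / 8 * (ε / (2 + ε))) := by field_simp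
      _ ≤ u ^ 3 * ψ * ((1 - ψ) ^ 3 * (c' / (1 + c'))) := by gcongr
      _ = u ^ 3 * ((1 - ψ) ^ 3 * c' * (ψ / (1 + c'))) := by ring
      _ ≤ _ := by
        gcongr
        exact Nat.le_ceil _
  have h3 : 0 < u * (ε / (8 * (2 + ε))) := by positivity
  rw [mul_assoc]
  gcongr
  rw [Real.exp_neg]
  calc (Real.exp _)⁻¹ ≤ (u * (ε / (8 * (2 + ε))))⁻¹ := by
        apply inv_anti₀ h3
        refine (h2.trans h1).trans ?_
        have := Real.add_one_le_exp ((laplaceStep ψ c')^[⌈ℓ / Real.log (1 + s)⌉₊ + ⌈u ^ 3⌉₊] (r / ψ))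
        linarith
    _ = 8 * (2 + ε) / ε * ψ := by rw [hψ]; field_simp

lemma saturation_error (h : Scales M N ℓ y u) {r : ℝ} (hr : r = (N - 1)⁻¹) :
    (Real.exp (-u⁻¹) + r) ^ ⌈u ^ 3⌉₊ / u⁻¹ ≤ 32 * u⁻¹ := by
  obtain ⟨hr0, -, -, hMr⟩ := h.step_bounds hr
  have hψ0 := h.inv_u_pos
  have hψ1 := h.inv_u_le
  have hM := h.hundred_le
  have hu := h.u_ge
  set ψ := u⁻¹ with hψ
  have h1 : Real.exp (-ψ) + r ≤ Real.exp (-(ψ / 4)) := by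
    have h2 : Real.exp (-ψ) ≤ 1 - ψ / 2 := by
      rw [Real.exp_neg, inv_le_iff_one_le_mul₀ (Real.exp_pos _)]
      have := Real.add_one_le_exp ψ
      have h3 : (1 - ψ / 2) * (ψ + 1) ≤ (1 - ψ / 2) * Real.exp ψ := by gcongr; linarith
      nlinarith
    have h3 := Real.add_one_le_exp (-(ψ / 4))
    nlinarith
  have h2 : (Real.exp (-ψ) + r) ^ ⌈u ^ 3⌉₊ ≤ Real.exp (-(u ^ 2 / 4)) := by
    refine (pow_le_pow_left₀ (by positivity) h1 _).trans ?_
    rw [← Real.exp_nat_mul]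
    apply Real.exp_le_exp.2
    have h3 : u ^ 3 * (ψ / 4) ≤ ⌈u ^ 3⌉₊ * (ψ / 4) := by
      gcongr
      exact Nat.le_ceil _
    have h4 : u ^ 3 * (ψ / 4) = u ^ 2 / 4 := by rw [hψ]; field_simp
    linarith
  have h3 : Real.exp (-(u ^ 2 / 4)) ≤ 32 * (ψ * ψ) := by
    rw [Real.exp_neg, inv_le_iff_one_le_mul₀ (Real.exp_pos _)]
    have h4 := Real.add_one_le_exp (u ^ 2 / 4)
    have h5 : 32 * (ψ * ψ) * (u ^ 2 / 4) ≤ 32 * (ψ * ψ) * Real.exp (u ^ 2 / 4) := by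
      gcongr; linarith
    have h6 : 32 * (ψ * ψ) * (u ^ 2 / 4) = 8 := by rw [hψ]; field_simp; norm_num
    linarith
  rw [div_le_iff₀ hψ0]
  linarith

lemma extinction_error (h : Scales M N ℓ y u) {ε c k r m : ℝ} (hε : 0 < ε) (hεc : ε ≤ c)
    (hcl : c ≤ ℓ ^ 2) (hM : 100 / ε ≤ M) (hr : r = (N - 1)⁻¹)
    (hk : k = c * N) (hm : m = min c (ℓ / 2)) :
    k * (Real.exp (-(r * ((1 - u⁻¹) * k))) + r) ^ ⌈(ℓ + 3 * y) / ((1 - 2 * u⁻¹) * m)⌉₊ ≤ u⁻¹ := by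
  obtain ⟨hr0, hrN, hr2, -⟩ := h.step_bounds hr
  have hψ0 := h.inv_u_pos
  have hψ1 := h.inv_u_le
  have hu := h.u_ge
  have hl := h.ell_ge
  have hN := h.N_ge
  have hc0 : 0 < c := hε.trans_le hεc
  have hhalf := h.exp_half_le (lt_min hε one_pos : 0 < min ε 1) (by
    rcases min_choice ε 1 with h1 | h1 <;> rw [h1]
    · exact hM
    · linarith [h.hundred_le])
  set ψ := u⁻¹ with hψ
  have hmc : m ≤ c := hm ▸ min_le_left _ _
  have hml : m ≤ ℓ / 2 := hm ▸ min_le_right _ _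
  have hmε : min ε 1 ≤ m := by
    rw [hm]
    exact min_le_min hεc (by linarith)
  have hm0 : 0 < m := (lt_min hε one_pos).trans_le hmε
  have hk0 : 0 < k := by rw [hk]; positivity
  have hck : c ≤ r * k := by
    have : N⁻¹ * k ≤ r * k := by gcongr
    rwa [hk, mul_comm c N, inv_mul_cancel_left₀ (by linarith), ← hk.trans (mul_comm c N)] at this
  have h1 : Real.exp (-(r * ((1 - ψ) * k))) + r ≤ Real.exp (-((1 - 2 * ψ) * m)) := by
    have h2 : Real.exp (-(r * ((1 - ψ) * k))) ≤ Real.exp (-((1 - ψ) * m)) := by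
      apply Real.exp_le_exp.2
      have : (1 - ψ) * m ≤ (1 - ψ) * (r * k) := by
        gcongr
        · linarith
        · linarith
      linarith
    have h3 : Real.exp (-((1 - 2 * ψ) * m)) = Real.exp (-((1 - ψ) * m)) * Real.exp (ψ * m) := by
      rw [← Real.exp_add]; ring_nf
    have h4 : Real.exp (-(ℓ / 2)) * (ψ * m) ≤ Real.exp (-((1 - ψ) * m)) * (Real.exp (ψ * m) - 1) := by
      gcongr
      · nlinarith
      · linarith [Real.add_one_le_exp (ψ * m)]
    have h5 : r ≤ Real.exp (-(ℓ / 2)) * (ψ * m) := by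
      have h6 : N⁻¹ = Real.exp (-(ℓ / 2)) * Real.exp (-(ℓ / 2)) := by
        rw [← Real.exp_add, ← h.exp_ell, ← Real.exp_neg]; ring_nf
      have h7 : 2 * Real.exp (-(ℓ / 2)) ≤ ψ * m := hhalf.trans (by gcongr)
      nlinarith [Real.exp_pos (-(ℓ / 2))]
    rw [h3]
    linarith
  have hden : 0 < (1 - 2 * ψ) * m := mul_pos (by linarith) hm0
  have h2 : (Real.exp (-(r * ((1 - ψ) * k))) + r) ^ ⌈(ℓ + 3 * y) / ((1 - 2 * ψ) * m)⌉₊ ≤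
      Real.exp (-(ℓ + 3 * y)) := by
    refine (pow_le_pow_left₀ (by positivity) h1 _).trans ?_
    rw [← Real.exp_nat_mul]
    apply Real.exp_le_exp.2
    have := (div_le_iff₀ hden).1 (Nat.le_ceil ((ℓ + 3 * y) / ((1 - 2 * ψ) * m)))
    linarith
  have h3 : Real.exp (-(ℓ + 3 * y)) = (N * ℓ ^ 3)⁻¹ := by
    rw [Real.exp_neg, Real.exp_add, h.exp_ell]
    congr 2
    rw [← h.exp_y, ← Real.exp_nat_mul]; norm_num
  calc _ ≤ ℓ ^ 2 * N * (N * ℓ ^ 3)⁻¹ := by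
        rw [h3] at h2
        rw [hk] at h2 ⊢
        gcongr
    _ = ℓ⁻¹ := by field_simp
    _ ≤ ψ := h.inv_ell_le

lemma half_time_error (h : Scales M N ℓ y u) {ε c k r : ℝ} (hε : 0 < ε) (hεc : ε ≤ c)
    (hr : r = (N - 1)⁻¹) (hk : k = c * N) :
    2 / k * (1 + r * k) ^ (⌊(1 - u⁻¹) * ℓ / Real.log (1 + r * k)⌋₊ + 1) ≤
      (2 / ε + 4) * u⁻¹ := by
  obtain ⟨hr0, hrN, hr2, -⟩ := h.step_bounds hr
  have hψ0 := h.inv_u_pos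
  have hψ1 := h.inv_u_le
  have hu := h.u_ge
  have hl := h.ell_ge
  have hN := h.N_ge
  have hc0 : 0 < c := hε.trans_le hεc
  set ψ := u⁻¹ with hψ
  have hk0 : 0 < k := by rw [hk]; positivity
  have hrk0 : 0 < r * k := by positivity
  have hlog : 0 < Real.log (1 + r * k) := Real.log_pos (by linarith)
  have h1 : (1 + r * k) ^ ⌊(1 - ψ) * ℓ / Real.log (1 + r * k)⌋₊ ≤ Real.exp ((1 - ψ) * ℓ) := by
    rw [← Real.exp_log (by positivity : 0 < (1 + r * k) ^ _), Real.log_pow]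
    apply Real.exp_le_exp.2
    rw [← le_div_iff₀ hlog]
    exact Nat.floor_le (div_nonneg (mul_nonneg (by linarith) (by linarith)) hlog.le)
  have h2 : Real.exp ((1 - ψ) * ℓ) ≤ N * ψ := by
    have h3 : (1 - ψ) * ℓ = ℓ + -(ψ * ℓ) := by ring
    rw [h3, Real.exp_add, h.exp_ell]
    gcongr
    rw [Real.exp_neg]
    apply inv_anti₀ (by linarith)
    have h4 := Real.add_one_le_exp (ψ * ℓ)
    have h5 : u ≤ ψ * ℓ := by
      rw [hψ, ← div_eq_inv_mul, le_div_iff₀ (by linarith)]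
      refine le_trans ?_ h.u_pow_le
      rw [← sq]
      exact pow_le_pow_right₀ (by linarith) (by norm_num)
    linarith
  have h3 : r * k ≤ 2 * c := by
    calc r * k ≤ 2 * N⁻¹ * k := by gcongr
      _ = 2 * c := by rw [hk]; field_simp
  rw [pow_succ]
  calc 2 / k * ((1 + r * k) ^ ⌊(1 - ψ) * ℓ / Real.log (1 + r * k)⌋₊ * (1 + r * k))
      ≤ 2 / k * ((N * ψ) * (1 + 2 * c)) := by
        have := h1.trans h2
        gcongr
    _ = (2 / c + 4) * ψ := by rw [hk]; field_simp; ring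
    _ ≤ (2 / ε + 4) * ψ := by gcongr

lemma survival_error (h : Scales M N ℓ y u) {ε c r : ℝ} {k : ℕ} (hε : 0 < ε) (hεc : ε ≤ c)
    (hM : 100 * ε ≤ M) (hr : r = (N - 1)⁻¹) (hk : (k : ℝ) = c * N) :
    ⌊(1 - u⁻¹) * ℓ / c⌋₊ * ((1 + r * k) / (ε * u⁻¹ / 8) ^ 2) /
      (k / 2 * ((1 - ε * u⁻¹ / 8) * (1 - r) ^ k) ^ ⌊(1 - u⁻¹) * ℓ / c⌋₊) ≤
      147456 / ε ^ 4 * u⁻¹ := by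
  obtain ⟨hr0, hrN, hr2, hMr⟩ := h.step_bounds hr
  have hψ0 := h.inv_u_pos
  have hψ1 := h.inv_u_le
  have hu := h.u_ge
  have hl := h.ell_ge
  have hN := h.N_ge
  have hM1 := h.hundred_le
  have hc0 : 0 < c := hε.trans_le hεc
  have hMu := h.le_u
  have hN4 : 4 / N ≤ u⁻¹ / 4 := by
    rw [div_eq_mul_inv]
    nlinarith
  have hη : ε * u⁻¹ ≤ 1 / 100 := by
    rw [← div_eq_mul_inv, div_le_iff₀ (by linarith)]
    linarith
  have hr3 : r < 1 / 2 := by nlinarith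
  have hrk : r * k ≤ 2 * c := by
    calc r * k ≤ 2 * N⁻¹ * k := by gcongr
      _ = 2 * c := by rw [hk]; field_simp
  set ψ := u⁻¹ with hψ
  set T := ⌊(1 - ψ) * ℓ / c⌋₊ with hT
  rcases Nat.eq_zero_or_pos T with h0 | hpos
  · rw [h0]
    simp only [Nat.cast_zero, zero_mul, zero_div]
    positivity
  have hTc : T * c ≤ (1 - ψ) * ℓ := by
    rw [← le_div_iff₀ hc0]
    exact Nat.floor_le (div_nonneg (mul_nonneg (by linarith) (by linarith)) hc0.le)
  have hT1 : (1 : ℝ) ≤ T := by exact_mod_cast hpos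
  have hcl : c ≤ ℓ := by nlinarith
  have hTε : T * ε ≤ ℓ := by
    have : T * ε ≤ T * c := by gcongr
    nlinarith
  have hη0 : 0 < ε * ψ / 8 := by positivity
  have h1 : Real.exp (-(ε * ψ / 4)) ≤ 1 - ε * ψ / 8 := by
    rw [Real.exp_neg, inv_le_iff_one_le_mul₀ (Real.exp_pos _)]
    have h2 := Real.add_one_le_exp (ε * ψ / 4)
    have h3 : (1 - ε * ψ / 8) * (ε * ψ / 4 + 1) ≤ (1 - ε * ψ / 8) * Real.exp (ε * ψ / 4) := by
      gcongr
      linarith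
    nlinarith
  have h2 : Real.exp (-(c * (1 + 4 / N))) ≤ (1 - r) ^ k := by
    have h3 : Real.exp (-(r / (1 - r))) ≤ 1 - r := by
      rw [Real.exp_neg]
      apply inv_le_of_inv_le₀ (by linarith)
      have h4 := Real.add_one_le_exp (r / (1 - r))
      have h5 : r / (1 - r) + 1 = (1 - r)⁻¹ := by
        have : 1 - r ≠ 0 := by linarith
        field_simp; ring
      linarith
    refine le_trans ?_ (pow_le_pow_left₀ (Real.exp_pos _).le h3 k)
    rw [← Real.exp_nat_mul]
    apply Real.exp_le_exp.2
    have h4 : r / (1 - r) = 1 / (N - 2) := by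
      have h5 : N - 1 ≠ 0 := by linarith
      have h6 : N - 2 ≠ 0 := by linarith
      have h7 : 1 - r = (N - 2) / (N - 1) := by rw [hr]; field_simp; ring
      rw [h7, hr]; field_simp
    have h5 : N * (1 / (N - 2)) ≤ 1 + 4 / N := by
      rw [mul_one_div, div_le_iff₀ (by linarith)]
      have h6 : (1 + 4 / N) * (N - 2) = N + 2 - 8 / N := by field_simp; ring
      have h7 : 8 / N ≤ 2 := by rw [div_le_iff₀ (by linarith)]; linarith
      linarith
    have h6 : k * (r / (1 - r)) ≤ c * (1 + 4 / N) := by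
      rw [h4, hk, mul_assoc]
      gcongr
    linarith
  have h3 : Real.exp (-(ℓ - ψ * ℓ / 2)) ≤ ((1 - ε * ψ / 8) * (1 - r) ^ k) ^ T := by
    have h4 : Real.exp (-(ε * ψ / 4)) * Real.exp (-(c * (1 + 4 / N))) ≤
        (1 - ε * ψ / 8) * (1 - r) ^ k :=
      mul_le_mul h1 h2 (Real.exp_pos _).le (by linarith)
    refine le_trans ?_ (pow_le_pow_left₀ (by positivity) h4 T)
    rw [← Real.exp_add, ← Real.exp_nat_mul]
    apply Real.exp_le_exp.2
    have h5 : T * c * (1 + 4 / N) ≤ (1 - ψ) * ℓ * (1 + ψ / 4) := by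
      gcongr
      nlinarith
    have h6 : T * ε * (ψ / 4) ≤ ℓ * (ψ / 4) := by gcongr
    have h7 : 0 ≤ ψ * ψ * ℓ := by positivity
    nlinarith
  have h4 : ℓ ^ 4 * ψ ^ 4 / 384 ≤ Real.exp (ψ * ℓ / 2) := by
    have h5 := Real.pow_div_factorial_le_exp (ψ * ℓ / 2) (by positivity) 4
    refine le_trans (le_of_eq ?_) h5
    norm_num [Nat.factorial]
    ring
  have h5 : ε / 2 * (ℓ ^ 4 * ψ ^ 4 / 384) ≤
      k / 2 * ((1 - ε * ψ / 8) * (1 - r) ^ k) ^ T := by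
    have h6 : Real.exp (-(ℓ - ψ * ℓ / 2)) = N⁻¹ * Real.exp (ψ * ℓ / 2) := by
      rw [neg_sub, sub_eq_neg_add, Real.exp_add, Real.exp_neg, h.exp_ell]
    calc ε / 2 * (ℓ ^ 4 * ψ ^ 4 / 384) ≤ c / 2 * Real.exp (ψ * ℓ / 2) := by gcongr
      _ = k / 2 * (N⁻¹ * Real.exp (ψ * ℓ / 2)) := by rw [hk]; field_simp
      _ ≤ _ := by
        rw [← h6]
        gcongr
  have h6 : T * ((1 + r * k) / (ε * ψ / 8) ^ 2) ≤ ℓ / ε * (3 * ℓ / (ε * ψ / 8) ^ 2) := by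
    have h7 : (T : ℝ) ≤ ℓ / ε := (le_div_iff₀ hε).2 hTε
    gcongr
    linarith
  calc _ ≤ ℓ / ε * (3 * ℓ / (ε * ψ / 8) ^ 2) / (ε / 2 * (ℓ ^ 4 * ψ ^ 4 / 384)) := by
        gcongr
    _ = 147456 / ε ^ 4 * (u ^ 6 / ℓ ^ 2) := by
        rw [hψ]; field_simp; norm_num
    _ ≤ _ := by
        gcongr
        rw [hψ, ← one_div, div_le_div_iff₀ (by positivity) (by positivity), one_mul]
        have := h.u_pow_le
        have := h.u_le_ell
        nlinarith

end Scales

end Asymptotics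

section Concentration

/-- Quantitative form of the concentration of the broadcasting time at a fixed large `n`. -/
lemma Scales.one_sub_le_probXiMem {M ℓ y u ε c : ℝ} {n k : ℕ} (h : Scales M n ℓ y u) (hε : 0 < ε)
    (hM₁ : 100 / ε ≤ M) (hM₂ : 100 / Real.log (1 + ε) ≤ M) (hM₃ : 100 * ε ≤ M)
    (hk : (k : ℝ) = c * n) (hεc : ε ≤ c) (hcl : c ≤ ℓ ^ 2) :
    1 - (Real.exp 1 * (8 * (2 + ε) / ε) + 33 + (2 / ε + 4) + 147456 / ε ^ 4) * u⁻¹ ≤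
      probXiMem n k {t | |(t : ℝ) / ((1 / Real.log (1 + c) + 1 / c) * ℓ) - 1|
        ≤ (12 / Real.log (1 + ε) + 5) * u⁻¹} := by
  have hN := h.N_ge
  have hn : 3 ≤ n := by
    have : (3 : ℝ) ≤ n := by linarith
    exact_mod_cast this
  have hc0 : 0 < c := hε.trans_le hεc
  have hk0 : k ≠ 0 := by
    have : (0 : ℝ) < k := by rw [hk]; positivity
    exact_mod_cast this.ne'
  have hψ0 := h.inv_u_pos
  have hψ1 := h.inv_u_le
  have hψε := h.inv_M_le_inv hε hM₁
  have hl := h.ell_ge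
  have hlε : 0 < Real.log (1 + ε) := Real.log_pos (by linarith)
  have hlc : 0 < Real.log (1 + c) := Real.log_pos (by linarith)
  obtain ⟨r, hr⟩ : ∃ r : ℝ, r = ((n : ℝ) - 1)⁻¹ := ⟨_, rfl⟩
  have hrk : r * k = c * (1 + r) := by
    have : (n : ℝ) - 1 ≠ 0 := by linarith
    rw [hk, hr]; field_simp; ring
  obtain ⟨hr0, -, -, -⟩ := h.step_bounds hr
  have hcrk : c ≤ r * k := by rw [hrk]; nlinarith
  have hup := h.upper_time hε hεc hcl hM₁ hM₂ (sub_le_sub_right hcrk u⁻¹) rfl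
  have hlow := h.lower_time hε hεc hcl hM₁ hM₂ hr hrk
  have hge := one_sub_probXiLe_le hn hk0 hr hψ0 (by linarith) (by linarith)
    (⌈ℓ / Real.log (1 + (1 - u⁻¹) ^ 3 * (r * k - u⁻¹))⌉₊ + ⌈u ^ 3⌉₊) ⌈u ^ 3⌉₊
    ⌈(ℓ + 3 * y) / ((1 - 2 * u⁻¹) * min c (ℓ / 2))⌉₊
  have hle := probXiLe_add_le hn hk0 hr (η := ε * u⁻¹ / 8) (by positivity) (by
      have := h.le_u
      have hu := h.u_ge
      have : ε * u⁻¹ ≤ 1 := by rw [← div_eq_mul_inv, div_le_iff₀ (by linarith)]; linarith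
      linarith)
    ⌊(1 - u⁻¹) * ℓ / Real.log (1 + r * k)⌋₊ ⌊(1 - u⁻¹) * ℓ / c⌋₊
  have hg := h.growth_error hε hεc hM₁ hr (sub_le_sub_right hcrk u⁻¹)
  have hs := h.saturation_error hr
  have hx := h.extinction_error hε hεc hcl hM₁ hr hk rfl
  have hh := h.half_time_error hε hεc hr hk
  have hv := h.survival_error hε hεc hM₃ hr hk
  have hmem := sub_le_probXiMem (show 2 ≤ n by omega) k
    (S := {t | |(t : ℝ) / ((1 / Real.log (1 + c) + 1 / c) * ℓ) - 1|
        ≤ (12 / Real.log (1 + ε) + 5) * u⁻¹})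
    (a := ⌊(1 - u⁻¹) * ℓ / Real.log (1 + r * k)⌋₊ + ⌊(1 - u⁻¹) * ℓ / c⌋₊)
    (b := ⌈ℓ / Real.log (1 + (1 - u⁻¹) ^ 3 * (r * k - u⁻¹))⌉₊ + ⌈u ^ 3⌉₊ + (⌈u ^ 3⌉₊ +
      ⌈(ℓ + 3 * y) / ((1 - 2 * u⁻¹) * min c (ℓ / 2))⌉₊))
    (fun t hat htb => by
      have hL : 0 < (1 / Real.log (1 + c) + 1 / c) * ℓ := by positivity
      have hat' : (⌊(1 - u⁻¹) * ℓ / Real.log (1 + r * k)⌋₊ : ℝ) + ⌊(1 - u⁻¹) * ℓ / c⌋₊ + 1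
          ≤ t := by exact_mod_cast hat
      have htb' : (t : ℝ) ≤
          ⌈ℓ / Real.log (1 + (1 - u⁻¹) ^ 3 * (r * k - u⁻¹))⌉₊ + ⌈u ^ 3⌉₊ + (⌈u ^ 3⌉₊ +
            ⌈(ℓ + 3 * y) / ((1 - 2 * u⁻¹) * min c (ℓ / 2))⌉₊) := by exact_mod_cast htb
      have h1 := (le_div_iff₀ hL).2 (hlow.trans hat')
      have h2 := (div_le_iff₀ hL).2 (htb'.trans hup)
      have h3 : 0 ≤ 12 / Real.log (1 + ε) * u⁻¹ := by positivity
      rw [Set.mem_ofPred_eq, abs_le]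
      constructor <;> linarith)
  linarith

lemma eventually_scales (M : ℝ) (hM : 100 ≤ M) :
    ∀ᶠ n : ℕ in atTop, Scales M n (Real.log n) (Real.log (Real.log n))
      (Real.sqrt (Real.log (Real.log (Real.log n)))) := by
  have hN : Tendsto (fun n : ℕ => (n : ℝ)) atTop atTop := tendsto_natCast_atTop_atTop
  have hl : Tendsto (fun n : ℕ => Real.log n) atTop atTop := Real.tendsto_log_atTop.comp hN
  have hy : Tendsto (fun n : ℕ => Real.log (Real.log n)) atTop atTop :=
    Real.tendsto_log_atTop.comp hl
  have hz : Tendsto (fun n : ℕ => Real.log (Real.log (Real.log n))) atTop atTop :=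
    Real.tendsto_log_atTop.comp hy
  have hpow : ∀ p : ℕ, ∀ᶠ x : ℝ in atTop, M * x ^ p ≤ Real.exp x := fun p => by
    filter_upwards [(Real.tendsto_exp_div_pow_atTop p).eventually_ge_atTop M, eventually_gt_atTop 0]
      with x h1 h2
    rwa [le_div_iff₀ (by positivity)] at h1
  filter_upwards [hN.eventually_gt_atTop 0, hl.eventually_gt_atTop 0, hy.eventually_ge_atTop 1,
    hz.eventually_ge_atTop (M ^ 2), hy.eventually (hpow 6), hl.eventually (hpow 10)]
    with n h1 h2 h3 h4 h5 h6
  rw [Real.exp_log h2] at h5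
  rw [Real.exp_log h1] at h6
  refine ⟨Real.exp_log h1, Real.exp_log h2, hM, Real.le_sqrt_of_sq_le h4, ?_, h5, h6⟩
  rw [Real.sqrt_le_left (by linarith)]
  have := Real.log_le_sub_one_of_pos (x := Real.log (Real.log n)) (by linarith)
  nlinarith

end Concentration

/-- **Theorem 4.5.**  Let `ε > 0` be a constant and suppose `k = k(n) = c(n)·n` where
`ε ≤ c(n) ≤ (ln n)²`.  Then there is a constant `C > 0` such that a.a.s.
`|ξ(K_n, k) / ((1/ln(1+c) + 1/c)·ln n) − 1| ≤ C/√(ln ln ln n)`. -/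
theorem broadcasting_time_linear_k
    (ε : ℝ) (hε : 0 < ε) (c : ℕ → ℝ) (k : ℕ → ℕ)
    (hkc : ∀ n, (k n : ℝ) = c n * n)
    (hc : ∀ᶠ n : ℕ in atTop, ε ≤ c n ∧ c n ≤ (Real.log n) ^ 2) :
    ∃ C > (0:ℝ), Tendsto (fun n =>
        probXiMem n (k n) {t |
          |(t : ℝ) / ((1 / Real.log (1 + c n) + 1 / c n) * Real.log n) - 1|
            ≤ C / Real.sqrt (Real.log (Real.log (Real.log n)))})
      atTop (nhds 1) := by
  set M : ℝ := 100 + 100 / ε + 100 / Real.log (1 + ε) + 100 * ε with hM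
  have hlε : 0 < Real.log (1 + ε) := Real.log_pos (by linarith)
  have h1 : 0 < 100 / ε := by positivity
  have h2 : 0 < 100 / Real.log (1 + ε) := by positivity
  refine ⟨12 / Real.log (1 + ε) + 5, by positivity, ?_⟩
  have hu : Tendsto (fun n : ℕ => (Real.sqrt (Real.log (Real.log (Real.log n))))⁻¹) atTop
      (nhds 0) :=
    tendsto_inv_atTop_zero.comp <| Real.tendsto_sqrt_atTop.comp <| Real.tendsto_log_atTop.comp <|
      Real.tendsto_log_atTop.comp <| Real.tendsto_log_atTop.comp tendsto_natCast_atTop_atTop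
  refine tendsto_of_tendsto_of_tendsto_of_le_of_le'
    (g := fun n : ℕ => 1 - (Real.exp 1 * (8 * (2 + ε) / ε) + 33 + (2 / ε + 4) + 147456 / ε ^ 4) *
      (Real.sqrt (Real.log (Real.log (Real.log n))))⁻¹) (h := fun _ => 1) ?_
    tendsto_const_nhds ?_ ?_
  · simpa using (hu.const_mul _).const_sub 1
  · filter_upwards [hc, eventually_scales M (by linarith)] with n hcn hs
    simp only [div_eq_mul_inv (12 / Real.log (1 + ε) + 5)]
    exact hs.one_sub_le_probXiMem hε (by linarith) (by linarith) (by linarith) (hkc n) hcn.1 hcn.2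
  · filter_upwards [eventually_ge_atTop 2] with n hn
    exact probXiMem_le_one hn _ _
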